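/- Let n ≥ 1 be an integer and q > 1. Let μ be a probability measure on ℝⁿ with finite first moment, zero barycenter (∫ y dμ(y) = 0), and not supported on any affine hyperplane. Then the minimization problem (P): minimize J(ρ) := F(ρ) + T(ρ,μ) over ρ ∈ P_1(ℝⁿ), admits a solution; i.e., there exists ρ̄ ∈ P_1(ℝⁿ) such that J(ρ̄) ≤ J(ρ) for every ρ ∈ P_1(ℝⁿ). -/

import Mathlib

open MeasureTheory Topology Filter Set
open scoped ENNReal RealInnerProductSpace

noncomputable section

abbrev En (n : ℕ) : Type := EuclideanSpace ℝ (Fin n)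

/-- The positive part of an extended real number, as an element of `ℝ≥0∞`. -/
def posPartNN (x : EReal) : ℝ≥0∞ := if x = ⊤ then ⊤ else ENNReal.ofReal x.toReal

/-- The integral of an `EReal`-valued function, with values in `EReal`
(defined as the integral of the positive part minus that of the negative part). -/
def eInt {X : Type*} [MeasurableSpace X] (ρ : Measure X) (g : X → EReal) : EReal :=
  ((∫⁻ x, posPartNN (g x) ∂ρ : ℝ≥0∞) : EReal) - ((∫⁻ x, posPartNN (-(g x)) ∂ρ : ℝ≥0∞) : EReal)

/-- Transport plans between `ρ` and `μ`. -/
def Plans {n : ℕ} (ρ μ : Measure (En n)) : Set (Measure (En n × En n)) :=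
  {γ | IsProbabilityMeasure γ ∧ γ.map Prod.fst = ρ ∧ γ.map Prod.snd = μ}

/-- The maximal correlation functional `T(ρ,μ)`. -/
def Tcorr {n : ℕ} (ρ μ : Measure (En n)) : EReal :=
  ⨆ γ ∈ Plans ρ μ, eInt γ (fun p => ((⟪p.1, p.2⟫ : ℝ) : EReal))

/-- The local functional `F(ρ) = ∫ f(ρ^ac) dx` with `f(t) = -t^α/α`, `α = 1 - 1/(n+q)`. -/
def Ffun (n : ℕ) (q : ℝ) (ρ : Measure (En n)) : EReal :=
  - ((∫⁻ x, ENNReal.ofReal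
      ((ρ.rnDeriv volume x).toReal ^ (1 - 1/((n : ℝ) + q)) / (1 - 1/((n : ℝ) + q)))
      ∂volume : ℝ≥0∞) : EReal)

/-- The functional `J(ρ) = F(ρ) + T(ρ,μ)`. -/
def Jfun (n : ℕ) (q : ℝ) (μ ρ : Measure (En n)) : EReal := Ffun n q ρ + Tcorr ρ μ

/-- Finite first moment. -/
def P1 {n : ℕ} (ρ : Measure (En n)) : Prop := Integrable (fun x : En n => ‖x‖) ρ

/-- `μ` is not supported on any affine hyperplane. -/
def NotHyperplane {n : ℕ} (μ : Measure (En n)) : Prop :=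
  ∀ (e : En n) (ℓ : ℝ), e ≠ 0 → μ {x | ⟪x, e⟫ = ℓ} ≠ 1

/-! ### Integrals of extended-real functions -/

theorem posPartNN_coe (r : ℝ) : posPartNN (r : EReal) = ENNReal.ofReal r := by
  simp [posPartNN]

theorem eInt_coe {X : Type*} [MeasurableSpace X] (ρ : Measure X) (f : X → ℝ) :
    eInt ρ (fun x => (f x : EReal)) =
      ((∫⁻ x, ENNReal.ofReal (f x) ∂ρ : ℝ≥0∞) : EReal)
        - ((∫⁻ x, ENNReal.ofReal (-f x) ∂ρ : ℝ≥0∞) : EReal) := by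
  simp only [eInt, ← EReal.coe_neg, posPartNN_coe]

theorem EReal.coe_ennreal_sub_of_ne_top {a b : ℝ≥0∞} (ha : a ≠ ⊤) (hb : b ≠ ⊤) :
    (a : EReal) - (b : EReal) = ((a.toReal - b.toReal : ℝ) : EReal) := by
  lift a to NNReal using ha
  lift b to NNReal using hb
  rfl

theorem lintegral_ofReal_ne_top {X : Type*} [MeasurableSpace X] {ρ : Measure X} {f : X → ℝ}
    (hf : Integrable f ρ) : ∫⁻ x, ENNReal.ofReal (f x) ∂ρ ≠ ⊤ :=
  ((lintegral_mono fun x => Real.ofReal_le_enorm (f x)).trans_lt hf.2).ne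

theorem eInt_coe_of_integrable {X : Type*} [MeasurableSpace X] {ρ : Measure X} {f : X → ℝ}
    (hf : Integrable f ρ) : eInt ρ (fun x => (f x : EReal)) = ((∫ x, f x ∂ρ : ℝ) : EReal) := by
  rw [eInt_coe, integral_eq_lintegral_pos_part_sub_lintegral_neg_part hf]
  exact EReal.coe_ennreal_sub_of_ne_top (lintegral_ofReal_ne_top hf)
    (lintegral_ofReal_ne_top hf.neg)

/-- Adding a function of zero integral does not decrease `eInt`. -/
theorem eInt_coe_le_of_integral_eq_zero {X : Type*} [MeasurableSpace X] {ρ : Measure X}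
    {f l : X → ℝ} (hf : Measurable f) (hl : Integrable l ρ) (hlm : Measurable l)
    (h0 : ∫ x, l x ∂ρ = 0) :
    eInt ρ (fun x => (f x : EReal)) ≤ eInt ρ (fun x => ((f x + l x : ℝ) : EReal)) := by
  rw [eInt_coe, eInt_coe]
  have hlp := lintegral_ofReal_ne_top hl
  have hln : ∫⁻ x, ENNReal.ofReal (-l x) ∂ρ ≠ ⊤ := lintegral_ofReal_ne_top hl.neg
  have hl0 : ∫⁻ x, ENNReal.ofReal (l x) ∂ρ = ∫⁻ x, ENNReal.ofReal (-l x) ∂ρ := by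
    rw [integral_eq_lintegral_pos_part_sub_lintegral_neg_part hl] at h0
    exact (ENNReal.toReal_eq_toReal_iff' hlp hln).1 (by linarith)
  have key : ∫⁻ x, ENNReal.ofReal (f x) ∂ρ + ∫⁻ x, ENNReal.ofReal (-(f x + l x)) ∂ρ
      = ∫⁻ x, ENNReal.ofReal (f x + l x) ∂ρ + ∫⁻ x, ENNReal.ofReal (-f x) ∂ρ := by
    refine (ENNReal.add_left_inj hlp).1 ?_
    nth_rewrite 2 [hl0]
    rw [← lintegral_add_left (by fun_prop), ← lintegral_add_left (by fun_prop),
      ← lintegral_add_left (by fun_prop), ← lintegral_add_left (by fun_prop)]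
    refine lintegral_congr fun x => ?_
    simp only [ENNReal.ofReal, ← ENNReal.coe_add, ENNReal.coe_inj, ← NNReal.coe_inj,
      NNReal.coe_add, Real.coe_toNNReal']
    grind
  have hneg : ∫⁻ x, ENNReal.ofReal (-(f x + l x)) ∂ρ
      ≤ ∫⁻ x, ENNReal.ofReal (-f x) ∂ρ + ∫⁻ x, ENNReal.ofReal (-l x) ∂ρ := by
    rw [← lintegral_add_left (by fun_prop)]
    refine lintegral_mono fun x => ?_
    rw [neg_add]
    exact ENNReal.ofReal_add_le
  generalize ∫⁻ x, ENNReal.ofReal (f x) ∂ρ = a at *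
  generalize ∫⁻ x, ENNReal.ofReal (-f x) ∂ρ = b at *
  generalize ∫⁻ x, ENNReal.ofReal (f x + l x) ∂ρ = c at *
  generalize ∫⁻ x, ENNReal.ofReal (-(f x + l x)) ∂ρ = d at *
  rcases eq_or_ne b ⊤ with rfl | hb
  · simp [sub_eq_add_neg]
  have hd : d ≠ ⊤ := ne_top_of_le_ne_top (ENNReal.add_ne_top.2 ⟨hb, hln⟩) hneg
  rcases eq_or_ne c ⊤ with rfl | hc
  · lift d to NNReal using hd
    have : ((⊤ : ℝ≥0∞) : EReal) - ((d : ℝ≥0∞) : EReal) = ⊤ := rfl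
    rw [this]
    exact le_top
  have ha : a ≠ ⊤ := by
    rintro rfl
    rw [top_add] at key
    exact ENNReal.add_ne_top.2 ⟨hc, hb⟩ key.symm
  rw [EReal.coe_ennreal_sub_of_ne_top ha hb, EReal.coe_ennreal_sub_of_ne_top hc hd,
    EReal.coe_le_coe_iff]
  have := congrArg ENNReal.toReal key
  rw [ENNReal.toReal_add ha hd, ENNReal.toReal_add hc hb] at this
  linarith

/-! ### Perturbations of the product plan -/

theorem integrable_norm_mul_norm_prod {n : ℕ} {ρ μ : Measure (En n)} [IsProbabilityMeasure ρ]
    [IsProbabilityMeasure μ] (hρ : P1 ρ) (hμ : P1 μ) :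
    Integrable (fun p : En n × En n => ‖p.1‖ * ‖p.2‖) (ρ.prod μ) :=
  Integrable.mul_prod hρ hμ

/-- A bounded perturbation with vanishing marginals of the product density is a transport plan. -/
theorem le_Tcorr_of_perturbation {n : ℕ} {ρ μ : Measure (En n)} [IsProbabilityMeasure ρ]
    [IsProbabilityMeasure μ] (hρ : P1 ρ) (hμ : P1 μ) (hbar : ∫ y, y ∂μ = (0 : En n))
    {h : En n → En n → ℝ} (hm : Measurable (Function.uncurry h)) {C : ℝ}
    (hC : ∀ x y, |h x y| ≤ C) (h1 : ∀ x y, -1 ≤ h x y)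
    (hx : ∀ x, ∫ y, h x y ∂μ = 0) (hy : ∀ y, ∫ x, h x y ∂ρ = 0) :
    ((∫ x, ∫ y, h x y * ⟪x, y⟫ ∂μ ∂ρ : ℝ) : EReal) ≤ Tcorr ρ μ := by
  set d : En n × En n → NNReal := fun p => (1 + h p.1 p.2).toNNReal with hd
  have hdm : Measurable d := by
    have : Measurable fun p : En n × En n => 1 + h p.1 p.2 := hm.const_add 1
    exact this.real_toNNReal
  set γ : Measure (En n × En n) := (ρ.prod μ).withDensity (fun p => (d p : ℝ≥0∞)) with hγ
  have hdx : ∀ x, ∫⁻ y, (d (x, y) : ℝ≥0∞) ∂μ = 1 := by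
    intro x
    have hi : Integrable (fun y => h x y) μ :=
      Integrable.of_bound (hm.comp measurable_prodMk_left).aestronglyMeasurable C
        (ae_of_all _ fun y => hC x y)
    have := ofReal_integral_eq_lintegral_ofReal (μ := μ) (f := fun y => 1 + h x y)
      ((integrable_const 1).add hi) (ae_of_all _ fun y => by have := h1 x y; simp; linarith)
    rw [integral_add (integrable_const 1) hi, hx x] at this
    simp only [integral_const, probReal_univ, smul_eq_mul, mul_one, add_zero, ENNReal.ofReal_one]
      at this
    exact this.symm
  have hdy : ∀ y, ∫⁻ x, (d (x, y) : ℝ≥0∞) ∂ρ = 1 := by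
    intro y
    have hi : Integrable (fun x => h x y) ρ :=
      Integrable.of_bound (hm.comp measurable_prodMk_right).aestronglyMeasurable C
        (ae_of_all _ fun x => hC x y)
    have := ofReal_integral_eq_lintegral_ofReal (μ := ρ) (f := fun x => 1 + h x y)
      ((integrable_const 1).add hi) (ae_of_all _ fun x => by have := h1 x y; simp; linarith)
    rw [integral_add (integrable_const 1) hi, hy y] at this
    simp only [integral_const, probReal_univ, smul_eq_mul, mul_one, add_zero, ENNReal.ofReal_one]
      at this
    exact this.symm
  have hfst : γ.map Prod.fst = ρ := by
    ext A hA
    rw [Measure.map_apply measurable_fst hA, hγ, withDensity_apply _ (measurable_fst hA),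
      ← lintegral_indicator (measurable_fst hA),
      lintegral_prod _ ((hdm.coe_nnreal_ennreal.indicator (measurable_fst hA)).aemeasurable)]
    have : ∀ x, ∫⁻ y, (Prod.fst ⁻¹' A).indicator (fun p => (d p : ℝ≥0∞)) (x, y) ∂μ
        = A.indicator 1 x := by
      intro x
      by_cases hxA : x ∈ A
      · simp [Set.indicator, hxA, hdx]
      · simp [Set.indicator, hxA]
    simp_rw [this]
    exact lintegral_indicator_one hA
  have hsnd : γ.map Prod.snd = μ := by
    ext A hA
    rw [Measure.map_apply measurable_snd hA, hγ, withDensity_apply _ (measurable_snd hA),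
      ← lintegral_indicator (measurable_snd hA),
      lintegral_prod_symm _ ((hdm.coe_nnreal_ennreal.indicator (measurable_snd hA)).aemeasurable)]
    have : ∀ y, ∫⁻ x, (Prod.snd ⁻¹' A).indicator (fun p => (d p : ℝ≥0∞)) (x, y) ∂ρ
        = A.indicator 1 y := by
      intro y
      by_cases hyA : y ∈ A
      · simp [Set.indicator, hyA, hdy]
      · simp [Set.indicator, hyA]
    simp_rw [this]
    exact lintegral_indicator_one hA
  have hγP : γ ∈ Plans ρ μ := by
    refine ⟨⟨?_⟩, hfst, hsnd⟩
    have : γ.map Prod.fst univ = 1 := by rw [hfst]; exact measure_univ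
    rwa [Measure.map_apply measurable_fst MeasurableSet.univ] at this
  have hprod := integrable_norm_mul_norm_prod hρ hμ
  have hinner : Measurable fun p : En n × En n => ⟪p.1, p.2⟫ := by fun_prop
  have hi0 : Integrable (fun p : En n × En n => ⟪p.1, p.2⟫) (ρ.prod μ) :=
    hprod.mono' hinner.aestronglyMeasurable (ae_of_all _ fun p => norm_inner_le_norm _ _)
  have hi1 : Integrable (fun p : En n × En n => h p.1 p.2 * ⟪p.1, p.2⟫) (ρ.prod μ) :=
    hi0.bdd_mul hm.aestronglyMeasurable (ae_of_all _ fun p => hC p.1 p.2)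
  have hsm : (fun p : En n × En n => d p • ⟪p.1, p.2⟫)
      = fun p => ⟪p.1, p.2⟫ + h p.1 p.2 * ⟪p.1, p.2⟫ := by
    ext p
    have := h1 p.1 p.2
    rw [NNReal.smul_def, hd]
    simp only [smul_eq_mul]
    rw [Real.coe_toNNReal _ (by linarith)]
    ring
  have hi2 : Integrable (fun p : En n × En n => ⟪p.1, p.2⟫) γ := by
    rw [hγ, integrable_withDensity_iff_integrable_smul hdm, hsm]
    exact hi0.add hi1
  refine le_trans ?_ (le_iSup₂ (f := fun γ (_ : γ ∈ Plans ρ μ) =>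
    eInt γ (fun p => ((⟪p.1, p.2⟫ : ℝ) : EReal))) γ hγP)
  rw [eInt_coe_of_integrable hi2, EReal.coe_le_coe_iff, hγ,
    integral_withDensity_eq_integral_smul hdm, hsm, integral_add hi0 hi1,
    integral_prod _ hi0, integral_prod _ hi1]
  have hzero : ∀ x : En n, ∫ y, ⟪x, y⟫ ∂μ = 0 := by
    intro x
    rw [integral_inner (𝕜 := ℝ) (f := fun y => y) ((integrable_norm_iff (by fun_prop)).1 hμ), hbar,
      inner_zero_right]
  simp [hzero]

/-! ### Translation invariance -/

theorem P1.integrable_id {n : ℕ} {ρ : Measure (En n)} (h : P1 ρ) :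
    Integrable (fun x : En n => x) ρ :=
  (integrable_norm_iff (by fun_prop)).1 h

theorem integral_inner_eq_zero {n : ℕ} {μ : Measure (En n)} (hμ : P1 μ)
    (hbar : ∫ y, y ∂μ = (0 : En n)) (x : En n) : ∫ y, ⟪x, y⟫ ∂μ = 0 := by
  rw [integral_inner (𝕜 := ℝ) (f := fun y => y) hμ.integrable_id, hbar, inner_zero_right]

theorem Tcorr_map_add_le {n : ℕ} {ρ μ : Measure (En n)} (hμ : P1 μ)
    (hbar : ∫ y, y ∂μ = (0 : En n)) (v : En n) :
    Tcorr (ρ.map (· + v)) μ ≤ Tcorr ρ μ := by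
  refine iSup₂_le fun γ hγ => ?_
  obtain ⟨hγ1, hγ2, hγ3⟩ := hγ
  have hS : Measurable fun p : En n × En n => (p.1 - v, p.2) := by fun_prop
  have hmem : γ.map (fun p : En n × En n => (p.1 - v, p.2)) ∈ Plans ρ μ := by
    refine ⟨Measure.isProbabilityMeasure_map hS.aemeasurable, ?_, ?_⟩
    · rw [Measure.map_map measurable_fst hS]
      have : (Prod.fst ∘ fun p : En n × En n => (p.1 - v, p.2)) = (fun x => x - v) ∘ Prod.fst := rfl
      rw [this, ← Measure.map_map (by fun_prop) measurable_fst, hγ2,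
        Measure.map_map (by fun_prop) (by fun_prop)]
      have : ((fun x : En n => x - v) ∘ fun x => x + v) = id := by ext1 x; simp
      rw [this, Measure.map_id]
    · rw [Measure.map_map measurable_snd hS]
      exact hγ3
  refine le_trans ?_ (le_iSup₂ (f := fun γ (_ : γ ∈ Plans ρ μ) =>
    eInt γ (fun p => ((⟪p.1, p.2⟫ : ℝ) : EReal))) _ hmem)
  have hl : Integrable (fun p : En n × En n => -⟪v, p.2⟫) γ := by
    have : Integrable (fun y : En n => -⟪v, y⟫) (γ.map Prod.snd) := by
      rw [hγ3]
      exact (hμ.integrable_id.const_inner v).neg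
    exact this.comp_measurable measurable_snd
  have hl0 : ∫ p, -⟪v, p.2⟫ ∂γ = 0 := by
    have := integral_map (μ := γ) (φ := Prod.snd) (by fun_prop) (f := fun y : En n => -⟪v, y⟫)
      (by fun_prop)
    rw [← this, hγ3, integral_neg, integral_inner_eq_zero hμ hbar, neg_zero]
  refine (eInt_coe_le_of_integral_eq_zero (f := fun p : En n × En n => ⟪p.1, p.2⟫) (by fun_prop) hl
    (by fun_prop) hl0).trans_eq ?_
  rw [eInt_coe, eInt_coe, lintegral_map (by fun_prop) hS, lintegral_map (by fun_prop) hS]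
  simp only [inner_sub_left, ← sub_eq_add_neg]

theorem Ffun_map_add {n : ℕ} {q : ℝ} {ρ : Measure (En n)} [IsFiniteMeasure ρ] (v : En n) :
    Ffun n q (ρ.map (· + v)) = Ffun n q ρ := by
  have hvol : (volume : Measure (En n)).map (· + v) = volume := map_add_right_eq_self _ v
  have hme : MeasurableEmbedding (fun x : En n => x + v) := measurableEmbedding_addRight v
  have := hme.rnDeriv_map ρ volume
  rw [hvol] at this
  unfold Ffun
  congr 2
  rw [← lintegral_add_right_eq_self _ v]
  refine lintegral_congr_ae ?_
  filter_upwards [this] with x hx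
  rw [hx]

/-! ### Coercivity of the maximal correlation functional -/

/-- The moment operator `e ↦ ∫ ⟪y, e⟫ / (1 + ‖y‖) • y dμ(y)`. -/
def momentOp {n : ℕ} (μ : Measure (En n)) (e : En n) : En n :=
  ∫ y, ((1 + ‖y‖)⁻¹ * ⟪y, e⟫) • y ∂μ

theorem abs_inv_mul_inner_le {n : ℕ} (y e : En n) : |(1 + ‖y‖)⁻¹ * ⟪y, e⟫| ≤ ‖e‖ := by
  rw [abs_mul, abs_of_nonneg (by positivity), inv_mul_le_iff₀ (by positivity)]
  nlinarith [abs_real_inner_le_norm y e, norm_nonneg e]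

theorem integrable_momentOp {n : ℕ} {μ : Measure (En n)} (hμ : P1 μ) (e : En n) :
    Integrable (fun y => ((1 + ‖y‖)⁻¹ * ⟪y, e⟫) • y) μ :=
  hμ.integrable_id.bdd_smul ‖e‖ (φ := fun y => (1 + ‖y‖)⁻¹ * ⟪y, e⟫)
    (Measurable.aestronglyMeasurable (by fun_prop))
    (ae_of_all _ fun y => abs_inv_mul_inner_le y e)

theorem momentOp_add {n : ℕ} {μ : Measure (En n)} (hμ : P1 μ) (e f : En n) :
    momentOp μ (e + f) = momentOp μ e + momentOp μ f := by
  unfold momentOp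
  rw [← integral_add (integrable_momentOp hμ e) (integrable_momentOp hμ f)]
  simp only [inner_add_right, mul_add, add_smul]

theorem momentOp_smul {n : ℕ} {μ : Measure (En n)} (c : ℝ) (e : En n) :
    momentOp μ (c • e) = c • momentOp μ e := by
  unfold momentOp
  rw [← integral_smul]
  refine integral_congr_ae (ae_of_all _ fun y => ?_)
  simp only [inner_smul_right, smul_smul]
  congr 1
  ring

theorem continuous_momentOp {n : ℕ} {μ : Measure (En n)} (hμ : P1 μ) :
    Continuous (momentOp μ) :=
  LinearMap.continuous_of_finiteDimensional
    (⟨⟨momentOp μ, momentOp_add hμ⟩, fun c e => momentOp_smul c e⟩ : En n →ₗ[ℝ] En n)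

theorem inner_momentOp {n : ℕ} {μ : Measure (En n)} (hμ : P1 μ) (x e : En n) :
    ∫ y, ((1 + ‖y‖)⁻¹ * ⟪y, e⟫) * ⟪x, y⟫ ∂μ = ⟪x, momentOp μ e⟫ := by
  rw [momentOp, ← integral_inner (𝕜 := ℝ) (integrable_momentOp hμ e)]
  simp only [inner_smul_right]

theorem inner_momentOp_self_pos {n : ℕ} {μ : Measure (En n)} [IsProbabilityMeasure μ] (hμ : P1 μ)
    (hplane : NotHyperplane μ) {e : En n} (he : e ≠ 0) : 0 < ⟪e, momentOp μ e⟫ := by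
  rw [← inner_momentOp hμ]
  have hint : Integrable (fun y => ((1 + ‖y‖)⁻¹ * ⟪y, e⟫) * ⟪e, y⟫) μ := by
    simpa only [inner_smul_right] using (integrable_momentOp hμ e).const_inner (𝕜 := ℝ) e
  have hnn : ∀ y : En n, 0 ≤ ((1 + ‖y‖)⁻¹ * ⟪y, e⟫) * ⟪e, y⟫ := by
    intro y
    rw [real_inner_comm, mul_assoc]
    exact mul_nonneg (by positivity) (mul_self_nonneg _)
  refine lt_of_le_of_ne (integral_nonneg hnn) fun h0 => hplane e 0 he ?_
  have := (integral_eq_zero_iff_of_nonneg hnn hint).1 h0.symm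
  rw [← prob_compl_eq_zero_iff (measurableSet_eq_fun (by fun_prop) (by fun_prop))]
  refine mem_ae_iff.1 ?_
  filter_upwards [this] with y hy
  have h1 : (1 + ‖y‖)⁻¹ * ⟪y, e⟫ * ⟪e, y⟫ = 0 := hy
  have h2 : (1 + ‖y‖)⁻¹ ≠ 0 := by positivity
  rw [real_inner_comm] at h1
  simpa [h2, real_inner_comm] using h1

theorem exists_momentOp_lower_bound {n : ℕ} (hn : 1 ≤ n) {μ : Measure (En n)}
    [IsProbabilityMeasure μ] (hμ : P1 μ) (hplane : NotHyperplane μ) :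
    ∃ c : ℝ, 0 < c ∧ ∀ x : En n, c * ‖x‖ ≤ ⟪x, momentOp μ (‖x‖⁻¹ • x)⟫ := by
  have : Nonempty (Fin n) := ⟨⟨0, hn⟩⟩
  obtain ⟨e, he, hmin⟩ := (isCompact_sphere (0 : En n) 1).exists_isMinOn
    (NormedSpace.sphere_nonempty.2 zero_le_one)
    (f := fun e => ⟪e, momentOp μ e⟫) (continuous_id.inner (continuous_momentOp hμ)).continuousOn
  have he0 : e ≠ 0 := by
    rintro rfl
    simp at he
  refine ⟨_, inner_momentOp_self_pos hμ hplane he0, fun x => ?_⟩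
  rcases eq_or_ne x 0 with rfl | hx
  · simp
  have hx' : 0 < ‖x‖ := norm_pos_iff.2 hx
  have := hmin (a := ‖x‖⁻¹ • x) (by simp [norm_smul, hx'.ne'])
  simp only [mem_ofPred_eq, inner_smul_left, map_inv₀, conj_trivial] at this
  rw [le_inv_mul_iff₀ hx'] at this
  linarith

theorem exists_coercivity {n : ℕ} (hn : 1 ≤ n) {μ : Measure (En n)}
    [IsProbabilityMeasure μ] (hμ : P1 μ) (hbar : ∫ y, y ∂μ = (0 : En n))
    (hplane : NotHyperplane μ) :
    ∃ c : ℝ, 0 < c ∧ ∀ ρ : Measure (En n), IsProbabilityMeasure ρ → P1 ρ →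
      ∫ x, x ∂ρ = (0 : En n) → ((c * ∫ x, ‖x‖ ∂ρ : ℝ) : EReal) ≤ Tcorr ρ μ := by
  obtain ⟨c, hc, hcx⟩ := exists_momentOp_lower_bound hn hμ hplane
  refine ⟨c / 4, by positivity, fun ρ _ hρ hρ0 => ?_⟩
  set s : En n → En n := fun x => ‖x‖⁻¹ • x with hs
  set θ : En n → En n := fun y => (1 + ‖y‖)⁻¹ • y with hθ
  have hs1 : ∀ x, ‖s x‖ ≤ 1 := fun x => by
    simp only [hs, norm_smul, norm_inv, norm_norm]
    exact inv_mul_le_one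
  have hθ1 : ∀ x, ‖θ x‖ ≤ 1 := fun x => by
    simp only [hθ, norm_smul, norm_inv]
    rw [Real.norm_of_nonneg (by positivity), inv_mul_le_iff₀ (by positivity)]
    linarith
  have hsm : Measurable s := by fun_prop
  have hθm : Measurable θ := by fun_prop
  have hsi : Integrable s ρ := Integrable.of_bound hsm.aestronglyMeasurable 1 (ae_of_all _ hs1)
  have hθi : Integrable θ μ := Integrable.of_bound hθm.aestronglyMeasurable 1 (ae_of_all _ hθ1)
  set sb : En n := ∫ x, s x ∂ρ with hsb
  set θb : En n := ∫ y, θ y ∂μ with hθb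
  have hsb1 : ‖sb‖ ≤ 1 := by
    simpa using norm_integral_le_of_norm_le_const (μ := ρ) (ae_of_all _ hs1)
  have hθb1 : ‖θb‖ ≤ 1 := by
    simpa using norm_integral_le_of_norm_le_const (μ := μ) (ae_of_all _ hθ1)
  set h : En n → En n → ℝ := fun x y => ⟪θ y - θb, s x - sb⟫ / 4 with hh
  have hC : ∀ x y, |h x y| ≤ 1 := by
    intro x y
    have h1 : ‖s x - sb‖ ≤ 2 := (norm_sub_le _ _).trans (by linarith [hs1 x])
    have h2 : ‖θ y - θb‖ ≤ 2 := (norm_sub_le _ _).trans (by linarith [hθ1 y])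
    rw [hh]
    simp only
    rw [abs_div, abs_of_pos (four_pos (α := ℝ)), div_le_one four_pos]
    refine (abs_real_inner_le_norm _ _).trans ?_
    nlinarith [norm_nonneg (s x - sb), norm_nonneg (θ y - θb)]
  have hm : Measurable (Function.uncurry h) := by
    have : Measurable fun p : En n × En n => ⟪θ p.2 - θb, s p.1 - sb⟫ / 4 :=
      (Measurable.inner ((hθm.comp measurable_snd).sub_const _)
        ((hsm.comp measurable_fst).sub_const _)).div_const 4
    exact this
  refine le_trans ?_ (le_Tcorr_of_perturbation hρ hμ hbar hm hC
    (fun x y => (abs_le.1 (hC x y)).1) ?_ ?_)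
  · rw [EReal.coe_le_coe_iff]
    have hin : ∀ x, ∫ y, h x y * ⟪x, y⟫ ∂μ
        = (⟪x, momentOp μ (s x)⟫ - ⟪x, momentOp μ sb⟫) / 4 := by
      intro x
      have e1 : ∀ e, Integrable (fun y => ((1 + ‖y‖)⁻¹ * ⟪y, e⟫) * ⟪x, y⟫) μ := fun e => by
        simpa only [inner_smul_right] using (integrable_momentOp hμ e).const_inner (𝕜 := ℝ) x
      have e2 : ∀ y, h x y * ⟪x, y⟫ = (((1 + ‖y‖)⁻¹ * ⟪y, s x⟫) * ⟪x, y⟫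
          - ((1 + ‖y‖)⁻¹ * ⟪y, sb⟫) * ⟪x, y⟫ - ⟪θb, s x - sb⟫ * ⟪x, y⟫) / 4 := by
        intro y
        simp only [hh, hθ, inner_sub_left, inner_sub_right, inner_smul_left, conj_trivial]
        ring
      simp_rw [e2]
      have e3 : Integrable (fun y => ((1 + ‖y‖)⁻¹ * ⟪y, s x⟫) * ⟪x, y⟫
          - ((1 + ‖y‖)⁻¹ * ⟪y, sb⟫) * ⟪x, y⟫) μ := (e1 _).sub (e1 _)
      rw [integral_div, integral_sub e3
        ((hμ.integrable_id.const_inner x).const_mul _), integral_sub (e1 _) (e1 _),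
        integral_const_mul, integral_inner_eq_zero hμ hbar, inner_momentOp hμ, inner_momentOp hμ]
      simp
    simp_rw [hin]
    have hsx : Integrable (fun x => ⟪x, momentOp μ (s x)⟫) ρ := by
      obtain ⟨K, hK⟩ := (isCompact_closedBall (0 : En n) 1).exists_bound_of_continuousOn
        (continuous_momentOp hμ).continuousOn
      refine (hρ.const_mul K).mono'
        (measurable_id.inner ((continuous_momentOp hμ).measurable.comp hsm)).aestronglyMeasurable
        (ae_of_all _ fun x => ?_)
      refine (norm_inner_le_norm _ _).trans ?_
      rw [mul_comm]
      exact mul_le_mul_of_nonneg_right (hK _ (by simpa using hs1 x)) (norm_nonneg _)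
    have hz : ∫ x, ⟪x, momentOp μ sb⟫ ∂ρ = 0 := by
      simp_rw [fun x : En n => real_inner_comm (momentOp μ sb) x]
      exact integral_inner_eq_zero hρ hρ0 _
    rw [integral_div, integral_sub hsx (hρ.integrable_id.inner_const _), hz, sub_zero,
      div_mul_eq_mul_div]
    gcongr
    rw [← integral_const_mul]
    exact integral_mono (hρ.const_mul c) hsx hcx
  · intro x
    simp only [hh]
    have hi : Integrable (fun y => θ y - θb) μ := hθi.sub (integrable_const _)
    rw [integral_div]
    simp_rw [fun y => real_inner_comm (s x - sb) (θ y - θb)]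
    rw [integral_inner (𝕜 := ℝ) hi, integral_sub hθi (integrable_const _)]
    simp [hθb]
  · intro y
    simp only [hh]
    have hi : Integrable (fun x => s x - sb) ρ := hsi.sub (integrable_const _)
    rw [integral_div, integral_inner (𝕜 := ℝ) hi,
      integral_sub hsi (integrable_const _)]
    simp [hsb]

/-! ### Lower semicontinuity of the maximal correlation functional -/

theorem exists_kernel_of_mem_Plans {n : ℕ} {ρ μ : Measure (En n)} {γ : Measure (En n × En n)}
    (hγ : γ ∈ Plans ρ μ) :
    ∃ κ : ProbabilityTheory.Kernel (En n) (En n), ProbabilityTheory.IsMarkovKernel κ ∧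
      ∀ f : En n × En n → ℝ, Integrable f γ → ∫ p, f p ∂γ = ∫ y, ∫ x, f (x, y) ∂(κ y) ∂μ := by
  obtain ⟨hγ1, hγ2, hγ3⟩ := hγ
  have : IsProbabilityMeasure (γ.map Prod.swap) :=
    Measure.isProbabilityMeasure_map measurable_swap.aemeasurable
  refine ⟨(γ.map Prod.swap).condKernel, inferInstance, fun f hf => ?_⟩
  have hfst : (γ.map Prod.swap).fst = μ := by
    rw [Measure.fst, Measure.map_map measurable_fst measurable_swap]
    exact hγ3
  have hd := (γ.map Prod.swap).disintegrate (γ.map Prod.swap).condKernel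
  rw [hfst] at hd
  have hsw : (γ.map Prod.swap).map Prod.swap = γ := by
    rw [Measure.map_map measurable_swap measurable_swap, Prod.swap_swap_eq, Measure.map_id]
  have hf' : Integrable (f ∘ Prod.swap) (γ.map Prod.swap) := by
    refine Integrable.comp_measurable ?_ measurable_swap
    rwa [hsw]
  have hμ : IsProbabilityMeasure μ := by
    rw [← hγ3]
    exact Measure.isProbabilityMeasure_map measurable_snd.aemeasurable
  have h1 : ∫ p, f p ∂γ = ∫ p, (f ∘ Prod.swap) p ∂(γ.map Prod.swap) := by
    conv_lhs => rw [← hsw]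
    refine integral_map measurable_swap.aemeasurable ?_
    rw [hsw]
    exact hf.1
  rw [h1]
  rw [← hd] at hf'
  conv_lhs => rw [← hd]
  rw [Measure.integral_compProd hf']
  rfl

/-- A finite continuous partition of unity on a ball, subordinate to small balls. -/
theorem exists_partition {n : ℕ} {R ε : ℝ} (hR : 0 ≤ R) (hε : 0 < ε) :
    ∃ (t : Finset (En n)) (χ : En n → En n → ℝ), (∀ z, Continuous (χ z)) ∧ (∀ z x, 0 ≤ χ z x) ∧
      (∀ z x, χ z x ≤ 1) ∧ (∀ x, ∑ z ∈ t, χ z x ≤ 1) ∧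
      (∀ x ∈ Metric.closedBall (0 : En n) R, ∑ z ∈ t, χ z x = 1) ∧
      ∀ z x, χ z x ≠ 0 → ‖x - z‖ ≤ ε := by
  obtain ⟨t, -, htf, ht⟩ := (isCompact_closedBall (0 : En n) R).finite_cover_balls hε
  lift t to Finset (En n) using htf
  classical
  set d : En n → En n → ℝ := fun z x => if z ∈ t then max 0 (ε - dist x z) else 0 with hd
  set I : En n → ℝ := fun x => Metric.infDist x (Metric.closedBall 0 R) with hI
  have hd0 : ∀ z x, 0 ≤ d z x := fun z x => by
    simp only [hd]
    split_ifs
    exacts [le_max_left _ _, le_rfl]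
  have hI0 : ∀ x, 0 ≤ I x := fun x => Metric.infDist_nonneg
  have hne : (Metric.closedBall (0 : En n) R).Nonempty := ⟨0, by simpa using hR⟩
  have hIb : ∀ x ∈ Metric.closedBall (0 : En n) R, I x = 0 := fun x hx =>
    Metric.infDist_zero_of_mem hx
  have hS0 : ∀ x, 0 ≤ ∑ z ∈ t, d z x := fun x => Finset.sum_nonneg fun z _ => hd0 z x
  have hS : ∀ x, 0 < (∑ z ∈ t, d z x) + I x := by
    intro x
    rcases (hI0 x).lt_or_eq with h | h
    · exact add_pos_of_nonneg_of_pos (hS0 x) h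
    · have hx : x ∈ Metric.closedBall (0 : En n) R :=
        (Metric.isClosed_closedBall.mem_iff_infDist_zero hne).2 h.symm
      obtain ⟨z, hz, hxz⟩ := mem_iUnion₂.1 (ht hx)
      refine add_pos_of_pos_of_nonneg (Finset.sum_pos' (fun z _ => hd0 z x) ⟨z, hz, ?_⟩) (hI0 x)
      have hdz : d z x = max 0 (ε - dist x z) := if_pos (Finset.mem_coe.1 hz)
      rw [hdz]
      exact lt_max_of_lt_right (by simpa using hxz)
  refine ⟨t, fun z x => d z x / ((∑ z ∈ t, d z x) + I x), ?_, ?_, ?_, ?_, ?_, ?_⟩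
  · intro z
    have hdc : ∀ z, Continuous (d z) := fun z => by
      by_cases hz : z ∈ t
      · simp only [hd, if_pos hz]
        fun_prop
      · simp only [hd, if_neg hz]
        fun_prop
    have hIc : Continuous I := Metric.continuous_infDist_pt _
    exact (hdc z).div ((continuous_finsetSum _ fun z _ => hdc z).add hIc) fun x => (hS x).ne'
  · exact fun z x => div_nonneg (hd0 z x) (hS x).le
  · intro z x
    rw [div_le_one (hS x)]
    by_cases hz : z ∈ t
    · linarith [hI0 x, Finset.single_le_sum (fun z _ => hd0 z x) hz]
    · simpa only [hd, if_neg hz] using (hS x).le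
  · intro x
    rw [← Finset.sum_div, div_le_one (hS x)]
    linarith [hI0 x]
  · intro x hx
    rw [← Finset.sum_div, div_eq_one_iff_eq (hS x).ne', hIb x hx, add_zero]
  · intro z x hx
    by_contra! h
    refine hx ?_
    have : d z x = 0 := by
      simp only [hd]
      split_ifs
      · exact max_eq_left (by rw [dist_eq_norm]; linarith)
      · rfl
    simp [this]

theorem exists_cutoff_radius {n : ℕ} {γ : Measure (En n × En n)} {t : ℝ}
    (ht : (t : EReal) < eInt γ (fun p => ((⟪p.1, p.2⟫ : ℝ) : EReal))) :
    ∃ R₀ : ℝ, ∀ ψ : En n → ℝ, Measurable ψ → (∀ x, 0 ≤ ψ x) → (∀ x, ψ x ≤ 1) →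
      (∀ x ∈ Metric.closedBall (0 : En n) R₀, ψ x = 1) →
      Integrable (fun p : En n × En n => ψ p.1 * ⟪p.1, p.2⟫) γ →
      t < ∫ p, ψ p.1 * ⟪p.1, p.2⟫ ∂γ := by
  rw [eInt_coe] at ht
  set P : ℝ≥0∞ := ∫⁻ p, ENNReal.ofReal ⟪p.1, p.2⟫ ∂γ with hP
  set N : ℝ≥0∞ := ∫⁻ p, ENNReal.ofReal (-⟪p.1, p.2⟫) ∂γ with hN
  have hNt : N ≠ ⊤ := by
    intro h
    rw [h] at ht
    simp [sub_eq_add_neg] at ht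
  set f : ℕ → En n × En n → ℝ≥0∞ := fun m =>
    {p | ‖p.1‖ ≤ m}.indicator fun p => ENNReal.ofReal ⟪p.1, p.2⟫ with hf
  have hset : ∀ m : ℕ, MeasurableSet {p : En n × En n | ‖p.1‖ ≤ m} := fun m =>
    measurableSet_le (by fun_prop) (by fun_prop)
  have hlim : Tendsto (fun m => ∫⁻ p, f m p ∂γ) atTop (𝓝 P) := by
    refine lintegral_tendsto_of_tendsto_of_monotone (fun m => ?_) (ae_of_all _ fun p => ?_)
      (ae_of_all _ fun p => ?_)
    · exact (Measurable.indicator (by fun_prop) (hset m)).aemeasurable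
    · intro a b hab
      refine indicator_le_indicator_of_subset (fun p hp => ?_) (fun _ => zero_le) p
      have hp' : ‖p.1‖ ≤ (a : ℝ) := hp
      exact hp'.trans (by exact_mod_cast hab)
    · obtain ⟨m₀, hm₀⟩ := exists_nat_ge ‖p.1‖
      refine tendsto_const_nhds.congr' ?_
      filter_upwards [eventually_ge_atTop m₀] with m hm
      have : p ∈ {p : En n × En n | ‖p.1‖ ≤ m} := hm₀.trans (by exact_mod_cast hm)
      simp only [hf, indicator_of_mem this]
  have hb : ((t + N.toReal : ℝ) : EReal) < (P : EReal) := by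
    clear_value N
    lift N to NNReal using hNt
    rw [EReal.coe_add]
    exact (EReal.lt_sub_iff_add_lt (Or.inl (by simp)) (Or.inl (by simp))).1 ht
  have hlimE : Tendsto (fun m => ((∫⁻ p, f m p ∂γ : ℝ≥0∞) : EReal)) atTop (𝓝 (P : EReal)) :=
    (continuous_coe_ennreal_ereal.tendsto P).comp hlim
  obtain ⟨m, hm⟩ := (hlimE.eventually_const_lt hb).exists
  refine ⟨m, fun ψ hψm hψ0 hψ1 hψ hi => ?_⟩
  rw [integral_eq_lintegral_pos_part_sub_lintegral_neg_part hi]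
  have h1 : ∫⁻ p, f m p ∂γ ≤ ∫⁻ p, ENNReal.ofReal (ψ p.1 * ⟪p.1, p.2⟫) ∂γ := by
    refine lintegral_mono fun p => ?_
    by_cases hp : p ∈ {p : En n × En n | ‖p.1‖ ≤ m}
    · have : ψ p.1 = 1 := hψ p.1 (mem_closedBall_zero_iff.2 hp)
      simp only [hf, indicator_of_mem hp, this, one_mul, le_refl]
    · simp only [hf, indicator_of_notMem hp, zero_le]
  have h2 : ∫⁻ p, ENNReal.ofReal (-(ψ p.1 * ⟪p.1, p.2⟫)) ∂γ ≤ N := by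
    refine lintegral_mono fun p => ?_
    rw [← mul_neg, ENNReal.ofReal_mul (hψ0 _)]
    exact mul_le_of_le_one_left zero_le (ENNReal.ofReal_le_one.2 (hψ1 _))
  have h3 := lintegral_ofReal_ne_top hi
  have h4 : t + N.toReal < (∫⁻ p, f m p ∂γ).toReal := by
    have h5 := ne_top_of_le_ne_top h3 h1
    generalize ∫⁻ p, f m p ∂γ = a at hm h5
    lift a to NNReal using h5
    exact EReal.coe_lt_coe_iff.1 hm
  have h6 := ENNReal.toReal_mono h3 h1
  have h7 := ENNReal.toReal_mono hNt h2
  linarith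

theorem cell_estimate {n : ℕ} {γ : Measure (En n × En n)} [IsProbabilityMeasure γ]
    (hγ : Integrable (fun p : En n × En n => ‖p.2‖) γ) {χ : En n → ℝ} (hχm : Measurable χ)
    (hχ0 : ∀ x, 0 ≤ χ x) (hχ1 : ∀ x, χ x ≤ 1) {z : En n} {ε : ℝ}
    (hχ : ∀ x, χ x ≠ 0 → ‖x - z‖ ≤ ε) :
    ∫ p, χ p.1 * ⟪p.1, p.2⟫ ∂γ - 2 * ε * ∫ p, χ p.1 * ‖p.2‖ ∂γ
      ≤ (∫ p, χ p.1 ∂γ)⁻¹ * ∫ p, χ p.1 * ⟪p.1, ∫ p, χ p.1 • p.2 ∂γ⟫ ∂γ := by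
  set w : En n := ∫ p, χ p.1 • p.2 ∂γ with hw
  set c : ℝ := ∫ p, χ p.1 ∂γ with hc
  have hb : ∀ x, ‖χ x‖ ≤ 1 := fun x => by
    rw [Real.norm_of_nonneg (hχ0 x)]
    exact hχ1 x
  have hχm' : Measurable fun p : En n × En n => χ p.1 := hχm.comp measurable_fst
  have hi1 : Integrable (fun p : En n × En n => χ p.1) γ :=
    Integrable.of_bound hχm'.aestronglyMeasurable 1 (ae_of_all _ fun p => hb p.1)
  have hi2 : Integrable (fun p : En n × En n => χ p.1 * ‖p.2‖) γ :=
    hγ.bdd_mul hχm'.aestronglyMeasurable (ae_of_all _ fun p => hb p.1)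
  have hi3 : Integrable (fun p : En n × En n => χ p.1 • p.2) γ :=
    ((integrable_norm_iff (by fun_prop)).1 hγ).bdd_smul (φ := fun p : En n × En n => χ p.1) 1
      hχm'.aestronglyMeasurable (ae_of_all _ fun p => hb p.1)
  have hwn : ‖w‖ ≤ ∫ p, χ p.1 * ‖p.2‖ ∂γ := by
    refine (norm_integral_le_integral_norm _).trans_eq ?_
    simp_rw [norm_smul, Real.norm_of_nonneg (hχ0 _)]
  have hloc : ∀ (x v : En n), |χ x * ⟪x - z, v⟫| ≤ ε * (χ x * ‖v‖) := by
    intro x v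
    rcases eq_or_ne (χ x) 0 with h | h
    · simp [h]
    · rw [abs_mul, abs_of_nonneg (hχ0 x)]
      have := (abs_real_inner_le_norm (x - z) v).trans
        (mul_le_mul_of_nonneg_right (hχ x h) (norm_nonneg v))
      nlinarith [hχ0 x]
  have hi4 : Integrable (fun p : En n × En n => χ p.1 * ⟪p.1 - z, p.2⟫) γ :=
    (hi2.const_mul ε).mono' (hχm'.mul (by fun_prop)).aestronglyMeasurable
      (ae_of_all _ fun p => hloc _ _)
  have hi5 : Integrable (fun p : En n × En n => χ p.1 * ⟪p.1 - z, w⟫) γ :=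
    ((hi1.mul_const ‖w‖).const_mul ε).mono' (hχm'.mul (by fun_prop)).aestronglyMeasurable
      (ae_of_all _ fun p => hloc _ _)
  have hi6 : Integrable (fun p : En n × En n => χ p.1 * ⟪z, p.2⟫) γ := by
    simpa only [inner_smul_right] using hi3.const_inner (𝕜 := ℝ) z
  have hzw : ∫ p, χ p.1 * ⟪z, p.2⟫ ∂γ = ⟪z, w⟫ := by
    rw [hw, ← integral_inner (𝕜 := ℝ) hi3]
    simp only [inner_smul_right]
  have e1 : ∫ p, χ p.1 * ⟪p.1, p.2⟫ ∂γ = ∫ p, χ p.1 * ⟪p.1 - z, p.2⟫ ∂γ + ⟪z, w⟫ := by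
    rw [← hzw, ← integral_add hi4 hi6]
    refine integral_congr_ae (ae_of_all _ fun p => ?_)
    simp only [inner_sub_left]
    ring
  have e2 : ∫ p, χ p.1 * ⟪p.1, w⟫ ∂γ = ∫ p, χ p.1 * ⟪p.1 - z, w⟫ ∂γ + c * ⟪z, w⟫ := by
    rw [hc, ← integral_mul_const, ← integral_add hi5 (hi1.mul_const _)]
    refine integral_congr_ae (ae_of_all _ fun p => ?_)
    simp only [inner_sub_left]
    ring
  have b1 : ∫ p, χ p.1 * ⟪p.1 - z, p.2⟫ ∂γ ≤ ε * ∫ p, χ p.1 * ‖p.2‖ ∂γ := by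
    rw [← integral_const_mul]
    exact integral_mono hi4 (hi2.const_mul ε) fun p => (le_abs_self _).trans (hloc _ _)
  have b2 : -(ε * (c * ‖w‖)) ≤ ∫ p, χ p.1 * ⟪p.1 - z, w⟫ ∂γ := by
    rw [hc, ← integral_mul_const, ← integral_const_mul, ← integral_neg]
    exact integral_mono ((hi1.mul_const ‖w‖).const_mul ε).neg hi5 fun p : En n × En n => by
      have := (abs_le.1 (hloc p.1 w)).1
      simp only
      linarith
  have hc0 : 0 ≤ c := integral_nonneg fun p : En n × En n => hχ0 p.1
  rcases hc0.eq_or_lt with h | h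
  · have hae : (fun p : En n × En n => χ p.1) =ᵐ[γ] 0 :=
      (integral_eq_zero_iff_of_nonneg (fun p : En n × En n => hχ0 p.1) hi1).1 h.symm
    have z1 : ∫ p, χ p.1 * ⟪p.1, p.2⟫ ∂γ = 0 := by
      refine integral_eq_zero_of_ae ?_
      filter_upwards [hae] with p hp
      have : χ p.1 = 0 := hp
      simp [this]
    have z2 : ∫ p, χ p.1 * ‖p.2‖ ∂γ = 0 := by
      refine integral_eq_zero_of_ae ?_
      filter_upwards [hae] with p hp
      have : χ p.1 = 0 := hp
      simp [this]
    rw [z1, z2, ← h]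
    simp
  · obtain ⟨p, hp⟩ : ∃ p : En n × En n, χ p.1 ≠ 0 := by
      by_contra! hcon
      simp [hc, hcon] at h
    have hε : 0 ≤ ε := (norm_nonneg _).trans (hχ _ hp)
    rw [e1, e2, mul_add, inv_mul_cancel_left₀ h.ne']
    have b3 : -(ε * ‖w‖) ≤ c⁻¹ * ∫ p, χ p.1 * ⟪p.1 - z, w⟫ ∂γ := by
      rw [le_inv_mul_iff₀ h]
      linarith
    nlinarith [mul_le_mul_of_nonneg_left hwn hε]

theorem sum_mul_div_lower_bound {ι : Type*} (t : Finset ι) {a b c d : ι → ℝ} {η : ℝ}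
    (ha : ∀ z, 0 ≤ a z) (hb : ∀ z, 0 ≤ b z) (hc : ∀ z, 0 ≤ c z) (hat : ∑ z ∈ t, a z ≤ 1)
    (hη : 0 ≤ η) (hbt : ∑ z ∈ t, b z ≤ 1) (hd : ∀ z ∈ t, 0 < c z → d z ≤ (1 + η) * c z)
    (hdt : 1 - η ≤ ∑ z ∈ t, if c z = 0 then 0 else d z) :
    -(1 + 2 * η) ≤ ∑ z ∈ t, (a z - d z) * (b z - c z) / c z := by
  have key : ∀ z ∈ t, -a z - (1 + η) * b z + (if c z = 0 then 0 else d z)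
      ≤ (a z - d z) * (b z - c z) / c z := by
    intro z hz
    rcases (hc z).eq_or_lt with h | h
    · simp only [← h, div_zero, if_true]
      nlinarith [ha z, hb z, mul_nonneg hη (hb z)]
    · rw [if_neg h.ne', le_div_iff₀ h]
      nlinarith [mul_nonneg (ha z) (hb z), mul_le_mul_of_nonneg_right (hd z hz h) (hb z)]
  refine le_trans ?_ (Finset.sum_le_sum key)
  rw [Finset.sum_add_distrib, Finset.sum_sub_distrib, Finset.sum_neg_distrib, ← Finset.mul_sum]
  nlinarith [mul_le_mul_of_nonneg_left hbt hη]

theorem sum_cell_le_Tcorr {n : ℕ} {ρ ρ' μ : Measure (En n)} {γ : Measure (En n × En n)}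
    [IsProbabilityMeasure ρ'] [IsProbabilityMeasure μ] (hγ : γ ∈ Plans ρ μ)
    (hρ' : P1 ρ') (hρ'0 : ∫ x, x ∂ρ' = (0 : En n))
    (hμ : P1 μ) (hbar : ∫ y, y ∂μ = (0 : En n)) {t : Finset (En n)} {χ : En n → En n → ℝ}
    (hχc : ∀ z, Continuous (χ z)) (hχ0 : ∀ z x, 0 ≤ χ z x) (hχ1 : ∀ z x, χ z x ≤ 1)
    (hχt : ∀ x, ∑ z ∈ t, χ z x ≤ 1) {η : ℝ} (hη : 0 ≤ η)
    (hle : ∀ z ∈ t, 0 < ∫ x, χ z x ∂ρ → ∫ x, χ z x ∂ρ' ≤ (1 + η) * ∫ x, χ z x ∂ρ)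
    (hsum : 1 - η ≤ ∑ z ∈ t, if ∫ x, χ z x ∂ρ = 0 then 0 else ∫ x, χ z x ∂ρ') :
    (((1 + 2 * η)⁻¹ * ∑ z ∈ t, (∫ x, χ z x ∂ρ)⁻¹ *
      ∫ x, χ z x * ⟪x, ∫ p, χ z p.1 • p.2 ∂γ⟫ ∂ρ' : ℝ) : EReal) ≤ Tcorr ρ' μ := by
  obtain ⟨κ, hκ, hκi⟩ := exists_kernel_of_mem_Plans hγ
  obtain ⟨hγ1, hγ2, hγ3⟩ := hγ
  have hρp : IsProbabilityMeasure ρ := by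
    rw [← hγ2]
    exact Measure.isProbabilityMeasure_map measurable_fst.aemeasurable
  have hb : ∀ z x, ‖χ z x‖ ≤ 1 := fun z x => by
    rw [Real.norm_of_nonneg (hχ0 z x)]
    exact hχ1 z x
  have hχi : ∀ z (ν : Measure (En n)) [IsProbabilityMeasure ν], Integrable (χ z) ν := fun z ν _ =>
    Integrable.of_bound (hχc z).aestronglyMeasurable 1 (ae_of_all _ (hb z))
  have hb01 : ∀ z (ν : Measure (En n)) [IsProbabilityMeasure ν],
      0 ≤ ∫ x, χ z x ∂ν ∧ ∫ x, χ z x ∂ν ≤ 1 := by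
    intro z ν _
    refine ⟨integral_nonneg (hχ0 z), ?_⟩
    simpa using integral_mono (hχi z ν) (integrable_const 1) (hχ1 z)
  set G : En n → En n → ℝ := fun z y => ∫ x, χ z x ∂(κ y) with hG
  set c : En n → ℝ := fun z => ∫ x, χ z x ∂ρ with hc
  set d : En n → ℝ := fun z => ∫ x, χ z x ∂ρ' with hd
  set w : En n → En n := fun z => ∫ p, χ z p.1 • p.2 ∂γ with hw
  have hGm : ∀ z, Measurable (G z) := fun z =>
    (hχc z).stronglyMeasurable.integral_kernel.measurable
  have hGt : ∀ y, ∑ z ∈ t, G z y ≤ 1 := by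
    intro y
    rw [hG, ← integral_finsetSum t fun z _ => hχi z (κ y)]
    simpa using integral_mono (integrable_finsetSum t fun z _ => hχi z (κ y))
      (integrable_const 1) hχt
  have hγsnd : Integrable (fun p : En n × En n => ‖p.2‖) γ := by
    have : Integrable (fun y : En n => ‖y‖) (γ.map Prod.snd) := by rwa [hγ3]
    exact this.comp_measurable measurable_snd
  have hχγ : ∀ z, Integrable (fun p : En n × En n => χ z p.1) γ := fun z => by
    have : Integrable (χ z) (γ.map Prod.fst) := by
      rw [hγ2]
      exact hχi z ρ
    exact this.comp_measurable measurable_fst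
  have hGint : ∀ z, ∫ y, G z y ∂μ = c z := by
    intro z
    rw [← hκi _ (hχγ z)]
    simp only [hc]
    rw [← hγ2, integral_map measurable_fst.aemeasurable (hχc z).aestronglyMeasurable]
  have hGi : ∀ z, Integrable (G z) μ := fun z =>
    Integrable.of_bound (hGm z).aestronglyMeasurable 1 (ae_of_all _ fun y => by
      rw [Real.norm_of_nonneg (hb01 z (κ y)).1]
      exact (hb01 z (κ y)).2)
  have hwi : ∀ z, Integrable (fun p : En n × En n => χ z p.1 • p.2) γ := fun z =>
    ((integrable_norm_iff (by fun_prop)).1 hγsnd).bdd_smul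
      (φ := fun p : En n × En n => χ z p.1) 1
      ((hχc z).comp continuous_fst).aestronglyMeasurable (ae_of_all _ fun p => hb z p.1)
  have hGw : ∀ z x, ∫ y, G z y * ⟪x, y⟫ ∂μ = ⟪x, w z⟫ := by
    intro z x
    rw [hw, ← integral_inner (𝕜 := ℝ) (hwi z), hκi _ ((hwi z).const_inner (𝕜 := ℝ) x)]
    simp only [inner_smul_right, integral_mul_const, hG]
  have hxy : ∀ x : En n, Integrable (fun y => ⟪x, y⟫) μ := fun x =>
    hμ.integrable_id.const_inner (𝕜 := ℝ) x
  have hGxy : ∀ z x, Integrable (fun y => (G z y - c z) * ⟪x, y⟫) μ := fun z x =>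
    (hxy x).bdd_mul (c := 1) ((hGm z).sub_const _).aestronglyMeasurable (ae_of_all _ fun y => by
      rw [Real.norm_eq_abs, abs_le]
      constructor <;> linarith [hb01 z (κ y), hb01 z ρ])
  have hxw : ∀ z, Integrable (fun x => ⟪x, w z⟫) ρ' := fun z =>
    hρ'.integrable_id.inner_const (𝕜 := ℝ) (w z)
  have hχxw : ∀ z, Integrable (fun x => χ z x * ⟪x, w z⟫) ρ' := fun z =>
    (hxw z).bdd_mul (hχc z).aestronglyMeasurable (ae_of_all _ (hb z))
  have hpos : 0 < 1 + 2 * η := by linarith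
  set h : En n → En n → ℝ := fun x y =>
    (1 + 2 * η)⁻¹ * ∑ z ∈ t, (χ z x - d z) * (G z y - c z) / c z with hh
  have hinner : ∀ x, ∫ y, h x y * ⟪x, y⟫ ∂μ =
      (1 + 2 * η)⁻¹ * ∑ z ∈ t, (c z)⁻¹ * (χ z x * ⟪x, w z⟫ - d z * ⟪x, w z⟫) := by
    intro x
    have : ∀ y, h x y * ⟪x, y⟫ = (1 + 2 * η)⁻¹ *
        ∑ z ∈ t, ((c z)⁻¹ * (χ z x - d z)) * ((G z y - c z) * ⟪x, y⟫) := by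
      intro y
      rw [hh]
      simp only
      rw [mul_assoc, Finset.sum_mul]
      congr 1
      refine Finset.sum_congr rfl fun z _ => ?_
      ring
    simp only [this]
    rw [integral_const_mul, integral_finsetSum _ fun z _ => (hGxy z x).const_mul _]
    congr 1
    refine Finset.sum_congr rfl fun z _ => ?_
    have e : ∫ y, (G z y - c z) * ⟪x, y⟫ ∂μ = ⟪x, w z⟫ := by
      have hG' : Integrable (fun y => G z y * ⟪x, y⟫) μ := by
        refine (hxy x).bdd_mul (c := 1) (hGm z).aestronglyMeasurable (ae_of_all _ fun y => ?_)
        rw [Real.norm_of_nonneg (hb01 z (κ y)).1]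
        exact (hb01 z (κ y)).2
      simp only [sub_mul]
      rw [integral_sub hG' ((hxy x).const_mul _), integral_const_mul,
        integral_inner_eq_zero hμ hbar, hGw]
      ring
    rw [integral_const_mul, e]
    ring
  have hmain : ∫ x, ∫ y, h x y * ⟪x, y⟫ ∂μ ∂ρ' =
      (1 + 2 * η)⁻¹ * ∑ z ∈ t, (c z)⁻¹ * ∫ x, χ z x * ⟪x, w z⟫ ∂ρ' := by
    simp only [hinner]
    have hi : ∀ z, Integrable (fun x => (c z)⁻¹ * (χ z x * ⟪x, w z⟫ - d z * ⟪x, w z⟫)) ρ' :=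
      fun z => ((hχxw z).sub ((hxw z).const_mul (d z))).const_mul _
    rw [integral_const_mul, integral_finsetSum _ fun z _ => hi z]
    congr 1
    refine Finset.sum_congr rfl fun z _ => ?_
    have e : ∫ x, ⟪x, w z⟫ ∂ρ' = 0 := by
      rw [← integral_inner_eq_zero hρ' hρ'0 (w z)]
      exact integral_congr_ae (ae_of_all _ fun x => real_inner_comm _ _)
    rw [integral_const_mul, integral_sub (hχxw z) ((hxw z).const_mul _), integral_const_mul, e]
    ring
  rw [← hmain]
  have hterm : ∀ x y z, |(χ z x - d z) * (G z y - c z) / c z| ≤ |(c z)⁻¹| := by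
    intro x y z
    rw [div_eq_mul_inv, abs_mul, abs_mul]
    refine mul_le_of_le_one_left (abs_nonneg _) (mul_le_one₀ ?_ (abs_nonneg _) ?_)
    · rw [abs_le]
      constructor <;> linarith [hχ0 z x, hχ1 z x, hb01 z ρ']
    · rw [abs_le]
      constructor <;> linarith [hb01 z (κ y), hb01 z ρ]
  refine le_Tcorr_of_perturbation hρ' hμ hbar (C := (1 + 2 * η)⁻¹ * ∑ z ∈ t, |(c z)⁻¹|)
    ?_ ?_ ?_ ?_ ?_
  · refine Measurable.const_mul (Finset.measurable_fun_sum t fun z _ => ?_) _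
    exact (((hχc z).measurable.comp measurable_fst).sub_const _).mul
      (((hGm z).comp measurable_snd).sub_const _) |>.div_const _
  · intro x y
    rw [abs_mul, abs_of_pos (inv_pos.2 hpos)]
    gcongr
    exact (Finset.abs_sum_le_sum_abs _ _).trans (Finset.sum_le_sum fun z _ => hterm x y z)
  · intro x y
    have := sum_mul_div_lower_bound t (a := fun z => χ z x) (b := fun z => G z y) (c := c)
      (d := d) (fun z => hχ0 z x) (fun z => (hb01 z (κ y)).1) (fun z => (hb01 z ρ).1) (hχt x) hη
      (hGt y) hle hsum
    rw [← neg_le_neg_iff, neg_neg, ← mul_neg, inv_mul_le_iff₀ hpos]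
    linarith
  · intro x
    have hi : ∀ z, Integrable (fun y => (χ z x - d z) * (G z y - c z) / c z) μ := fun z =>
      (((hGi z).sub (integrable_const _)).const_mul _).div_const _
    rw [integral_const_mul, integral_finsetSum _ fun z _ => hi z]
    simp [integral_const_mul, integral_div, integral_sub (hGi _) (integrable_const _), hGint]
  · intro y
    have hi : ∀ z, Integrable (fun x => (χ z x - d z) * (G z y - c z) / c z) ρ' := fun z =>
      (((hχi z ρ').sub (integrable_const _)).mul_const _).div_const _
    rw [integral_const_mul, integral_finsetSum _ fun z _ => hi z]
    simp [integral_mul_const, integral_div, integral_sub (hχi _ ρ') (integrable_const _), hd]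

theorem tendsto_integral_of_continuous_of_bounded {n : ℕ} {ρk : ℕ → ProbabilityMeasure (En n)}
    {ρ : ProbabilityMeasure (En n)} (hlim : Tendsto ρk atTop (𝓝 ρ)) {f : En n → ℝ}
    (hf : Continuous f) {C : ℝ} (hC : ∀ x, ‖f x‖ ≤ C) :
    Tendsto (fun k => ∫ x, f x ∂(ρk k : Measure (En n))) atTop
      (𝓝 (∫ x, f x ∂(ρ : Measure (En n)))) :=
  ProbabilityMeasure.tendsto_iff_forall_integral_tendsto.1 hlim
    (BoundedContinuousFunction.ofNormedAddCommGroup f hf C hC)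

theorem exists_lt_measureReal_closedBall {n : ℕ} (ρ : Measure (En n)) [IsProbabilityMeasure ρ]
    {a : ℝ} (ha : a < 1) (R₀ : ℝ) : ∃ R, R₀ ≤ R ∧ 0 ≤ R ∧ a < ρ.real (Metric.closedBall 0 R) := by
  have h := tendsto_measure_iUnion_atTop (μ := ρ)
    (s := fun m : ℕ => Metric.closedBall (0 : En n) m)
    (fun i j hij => Metric.closedBall_subset_closedBall (by exact_mod_cast hij))
  rw [Metric.iUnion_closedBall_nat, measure_univ] at h
  have h' := (ENNReal.tendsto_toReal ENNReal.one_ne_top).comp h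
  obtain ⟨m₀, hm₀⟩ := exists_nat_ge R₀
  obtain ⟨m, hm, hm'⟩ :=
    ((h'.eventually_const_lt (by simpa using ha)).and (eventually_ge_atTop m₀)).exists
  exact ⟨m, hm₀.trans (by exact_mod_cast hm'), m.cast_nonneg, hm⟩

/-- The maximal correlation functional is lower semicontinuous along weakly convergent sequences
of centered measures. -/
theorem eventually_lt_Tcorr {n : ℕ} {μ : Measure (En n)} [IsProbabilityMeasure μ] (hμ : P1 μ)
    (hbar : ∫ y, y ∂μ = (0 : En n)) {ρk : ℕ → ProbabilityMeasure (En n)}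
    {ρ : ProbabilityMeasure (En n)} (hlim : Tendsto ρk atTop (𝓝 ρ))
    (hk : ∀ k, P1 (ρk k : Measure (En n)))
    (hk0 : ∀ k, ∫ x, x ∂(ρk k : Measure (En n)) = 0) {t : ℝ}
    (ht : (t : EReal) < Tcorr (ρ : Measure (En n)) μ) :
    ∀ᶠ k in atTop, (t : EReal) < Tcorr (ρk k : Measure (En n)) μ := by
  unfold Tcorr at ht
  simp only [lt_iSup_iff] at ht
  obtain ⟨γ, hγ, htγ⟩ := ht
  obtain ⟨t', htt', ht'⟩ := EReal.lt_iff_exists_real_btwn.1 htγ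
  rw [EReal.coe_lt_coe_iff] at htt'
  have hγ' := hγ
  obtain ⟨hγ1, hγ2, hγ3⟩ := hγ'
  have hγsnd : Integrable (fun p : En n × En n => ‖p.2‖) γ := by
    have : Integrable (fun y : En n => ‖y‖) (γ.map Prod.snd) := by rwa [hγ3]
    exact this.comp_measurable measurable_snd
  set M : ℝ := ∫ p, ‖p.2‖ ∂γ with hM
  obtain ⟨η, hηt, hη⟩ : ∃ η : ℝ, t < (1 + 2 * η)⁻¹ * (t' - 2 * η * M) ∧ 0 < η := by
    have hc : ContinuousAt (fun η : ℝ => (1 + 2 * η)⁻¹ * (t' - 2 * η * M)) 0 := by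
      refine ContinuousAt.mul (ContinuousAt.inv₀ (by fun_prop) (by simp)) (by fun_prop)
    have := (hc.tendsto.eventually_const_lt (u := t) (by simpa using htt')).filter_mono
      (nhdsWithin_le_nhds (s := Ioi 0))
    obtain ⟨η, h1, h2⟩ := (this.and self_mem_nhdsWithin).exists
    exact ⟨η, h1, h2⟩
  obtain ⟨R₀, hR₀⟩ := exists_cutoff_radius ht'
  obtain ⟨R, hRR₀, hR0, hR⟩ := exists_lt_measureReal_closedBall (ρ : Measure (En n))
    (show 1 - η < 1 by linarith) R₀
  obtain ⟨s, χ, hχc, hχ0, hχ1, hχs, hχR, hχz⟩ := exists_partition hR0 hη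
  have hb : ∀ z x, ‖χ z x‖ ≤ 1 := fun z x => by
    rw [Real.norm_of_nonneg (hχ0 z x)]
    exact hχ1 z x
  set w : En n → En n := fun z => ∫ p, χ z p.1 • p.2 ∂γ with hw
  set c : En n → ℝ := fun z => ∫ x, χ z x ∂(ρ : Measure (En n)) with hc
  have hc0 : ∀ z, 0 ≤ c z := fun z => integral_nonneg (hχ0 z)
  have hct : ∀ z, Tendsto (fun k => ∫ x, χ z x ∂(ρk k : Measure (En n))) atTop (𝓝 (c z)) :=
    fun z => tendsto_integral_of_continuous_of_bounded hlim (hχc z) (hb z)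
  have hloc : ∀ z x v, ‖χ z x * ⟪x, v⟫‖ ≤ (‖z‖ + η) * ‖v‖ := by
    intro z x v
    rcases eq_or_ne (χ z x) 0 with h | h
    · rw [h, zero_mul, norm_zero]
      positivity
    · have h1 : ‖x‖ ≤ ‖z‖ + η := by
        have := norm_le_norm_add_norm_sub' x z
        linarith [hχz z x h]
      rw [norm_mul, ← one_mul ((‖z‖ + η) * ‖v‖)]
      refine mul_le_mul (hb z x) ((abs_real_inner_le_norm x v).trans ?_) (norm_nonneg _) zero_le_one
      gcongr
  have hχi : ∀ z, Integrable (χ z) (ρ : Measure (En n)) := fun z =>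
    Integrable.of_bound (hχc z).aestronglyMeasurable 1 (ae_of_all _ (hb z))
  have hmass : 1 - η < ∑ z ∈ s, c z := by
    refine hR.trans_le ?_
    rw [hc, ← integral_finsetSum s fun z _ => hχi z,
      ← integral_indicator_one Metric.isClosed_closedBall.measurableSet]
    refine integral_mono ((integrable_const 1).indicator Metric.isClosed_closedBall.measurableSet)
      (integrable_finsetSum s fun z _ => hχi z) fun x => ?_
    by_cases hx : x ∈ Metric.closedBall (0 : En n) R
    · rw [indicator_of_mem hx]
      exact (hχR x hx).ge
    · rw [indicator_of_notMem hx]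
      exact Finset.sum_nonneg fun z _ => hχ0 z x
  have hχmapfst : ∀ f : En n → ℝ, Continuous f →
      ∫ p, f p.1 ∂γ = ∫ x, f x ∂(ρ : Measure (En n)) := fun f hf => by
    rw [← hγ2, integral_map measurable_fst.aemeasurable hf.aestronglyMeasurable]
  have hχm : ∀ z, Continuous fun p : En n × En n => χ z p.1 := fun z =>
    (hχc z).comp continuous_fst
  have hi1 : ∀ z, Integrable (fun p : En n × En n => χ z p.1 * ⟪p.1, p.2⟫) γ := fun z =>
    (hγsnd.const_mul (‖z‖ + η)).mono' ((hχm z).mul (by fun_prop)).aestronglyMeasurable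
      (ae_of_all _ fun p => hloc z p.1 p.2)
  have hi2 : ∀ z, Integrable (fun p : En n × En n => χ z p.1 * ‖p.2‖) γ := fun z =>
    hγsnd.bdd_mul (hχm z).aestronglyMeasurable (ae_of_all _ fun p => hb z p.1)
  have hvalue : t' - 2 * η * M ≤
      ∑ z ∈ s, (c z)⁻¹ * ∫ x, χ z x * ⟪x, w z⟫ ∂(ρ : Measure (En n)) := by
    have h1 : ∀ z ∈ s, ∫ p, χ z p.1 * ⟪p.1, p.2⟫ ∂γ - 2 * η * ∫ p, χ z p.1 * ‖p.2‖ ∂γ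
        ≤ (c z)⁻¹ * ∫ x, χ z x * ⟪x, w z⟫ ∂(ρ : Measure (En n)) := by
      intro z _
      have := cell_estimate hγsnd (hχc z).measurable (hχ0 z) (hχ1 z) (hχz z)
      rwa [hχmapfst _ (hχc z), hχmapfst (fun x => χ z x * ⟪x, w z⟫)
        ((hχc z).mul (by fun_prop))] at this
    refine le_trans ?_ (Finset.sum_le_sum h1)
    rw [Finset.sum_sub_distrib, ← Finset.mul_sum, ← integral_finsetSum s fun z _ => hi1 z,
      ← integral_finsetSum s fun z _ => hi2 z]
    have h2 : t' < ∫ p, ∑ z ∈ s, χ z p.1 * ⟪p.1, p.2⟫ ∂γ := by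
      have hi := integrable_finsetSum s fun z _ => hi1 z
      simp only [← Finset.sum_mul] at hi ⊢
      exact hR₀ (fun x => ∑ z ∈ s, χ z x)
        (Finset.measurable_fun_sum s fun z _ => (hχc z).measurable)
        (fun x => Finset.sum_nonneg fun z _ => hχ0 z x) hχs
        (fun x hx => hχR x (Metric.closedBall_subset_closedBall hRR₀ hx)) hi
    have h3 : ∫ p, ∑ z ∈ s, χ z p.1 * ‖p.2‖ ∂γ ≤ M := by
      refine integral_mono (integrable_finsetSum s fun z _ => hi2 z) hγsnd fun p => ?_
      simp only [← Finset.sum_mul]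
      exact mul_le_of_le_one_left (norm_nonneg _) (hχs _)
    nlinarith
  have hlimval : Tendsto (fun k => (1 + 2 * η)⁻¹ * ∑ z ∈ s, (c z)⁻¹ *
      ∫ x, χ z x * ⟪x, w z⟫ ∂(ρk k : Measure (En n))) atTop (𝓝 ((1 + 2 * η)⁻¹ * ∑ z ∈ s,
      (c z)⁻¹ * ∫ x, χ z x * ⟪x, w z⟫ ∂(ρ : Measure (En n)))) := by
    refine (tendsto_finsetSum s fun z _ => ?_).const_mul _
    exact (tendsto_integral_of_continuous_of_bounded hlim
      ((hχc z).mul (by fun_prop)) fun x => hloc z x (w z)).const_mul _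
  have hev1 := hlimval.eventually_const_lt (u := t) (hηt.trans_le
    (mul_le_mul_of_nonneg_left hvalue (by positivity)))
  have hev2 : ∀ᶠ k in atTop, ∀ z ∈ s, 0 < c z →
      ∫ x, χ z x ∂(ρk k : Measure (En n)) ≤ (1 + η) * c z := by
    refine (Finset.eventually_all s).2 fun z _ => ?_
    rcases (hc0 z).eq_or_lt with h | h
    · exact Eventually.of_forall fun k hk => absurd hk h.not_lt
    · filter_upwards [(hct z).eventually_lt_const (u := (1 + η) * c z) (by nlinarith)] with k hk _
      exact hk.le
  have hev3 : ∀ᶠ k in atTop, 1 - η < ∑ z ∈ s,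
      if c z = 0 then 0 else ∫ x, χ z x ∂(ρk k : Measure (En n)) := by
    have : Tendsto (fun k => ∑ z ∈ s, if c z = 0 then 0 else ∫ x, χ z x ∂(ρk k : Measure (En n)))
        atTop (𝓝 (∑ z ∈ s, c z)) := by
      refine tendsto_finsetSum s fun z _ => ?_
      by_cases h : c z = 0
      · simp only [h, if_true, tendsto_const_nhds]
      · simpa only [h, if_false] using hct z
    exact this.eventually_const_lt hmass
  filter_upwards [hev1, hev2, hev3] with k h1 h2 h3
  exact (EReal.coe_lt_coe_iff.2 h1).trans_le (sum_cell_le_Tcorr hγ (hk k) (hk0 k) hμ hbar hχc hχ0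
    hχ1 hχs hη.le h2 h3.le)

/-! ### Upper semicontinuity of `∫ (ρ^ac)^α` -/

theorem ENNReal.rpow_le_min_rpow_add {a b : ℝ≥0∞} (hb0 : b ≠ 0) (hbt : b ≠ ⊤) {α : ℝ}
    (hα : α ≤ 1) : a ^ α ≤ min a b ^ α + b ^ (α - 1) * a := by
  rcases le_total a b with h | h
  · rw [min_eq_left h]
    exact le_self_add
  · refine le_add_left ?_
    rcases eq_or_ne a ⊤ with rfl | hat
    · rw [ENNReal.mul_top (ENNReal.rpow_pos (pos_iff_ne_zero.2 hb0) hbt).ne']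
      exact le_top
    · have ha0 : a ≠ 0 := ((pos_iff_ne_zero.2 hb0).trans_le h).ne'
      calc a ^ α = a ^ (α - 1) * a := by
            conv_rhs => rw [← ENNReal.rpow_one a, ← ENNReal.rpow_mul, one_mul,
              ← ENNReal.rpow_add _ _ ha0 hat, sub_add_cancel]
        _ ≤ b ^ (α - 1) * a := by
            refine mul_le_mul_left ?_ a
            have e : α - 1 = -(1 - α) := by ring
            rw [e, ENNReal.rpow_neg, ENNReal.rpow_neg]
            exact ENNReal.inv_le_inv.2 (ENNReal.rpow_le_rpow h (by linarith))

/-- The weight `1 + ‖x‖`. -/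
def weight {n : ℕ} (x : En n) : ℝ≥0∞ := ENNReal.ofReal (1 + ‖x‖)

theorem weight_ne_zero {n : ℕ} (x : En n) : weight x ≠ 0 := by
  simp only [weight, ne_eq, ENNReal.ofReal_eq_zero, not_le]
  positivity

theorem weight_ne_top {n : ℕ} (x : En n) : weight x ≠ ⊤ := ENNReal.ofReal_ne_top

@[fun_prop]
theorem measurable_weight {n : ℕ} : Measurable (weight (n := n)) := by
  unfold weight
  fun_prop

theorem lintegral_weight_rpow_ne_top {n : ℕ} {s : ℝ} (hs : n + 1 < s) :
    ∫⁻ x : En n, weight x ^ (-(s - 1)) ≠ ⊤ := by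
  have := finite_integral_one_add_norm (E := En n) (μ := volume) (r := s - 1)
    (by rw [finrank_euclideanSpace_fin]; linarith)
  refine ne_top_of_le_ne_top this.ne (lintegral_mono fun x => ?_)
  rw [weight, ENNReal.ofReal_rpow_of_pos (by positivity)]

theorem one_sub_one_div_lt_one {n : ℕ} {s : ℝ} (hs : n + 1 < s) :
    0 < 1 - 1 / s ∧ 1 - 1 / s < 1 := by
  have h1 : 1 < s := by linarith [(n.cast_nonneg : (0 : ℝ) ≤ n)]
  have h2 : 1 / s < 1 := (div_lt_one (by linarith)).2 h1
  have h3 : 0 < 1 / s := by positivity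
  constructor <;> linarith

/-- Truncation of the power function at the level `N * weight ^ (-s)`. -/
theorem rpow_le_min_rpow_add_weight {n : ℕ} {s : ℝ} (hs : n + 1 < s) {N : ℝ≥0∞} (hN0 : N ≠ 0)
    (hNt : N ≠ ⊤) (a : ℝ≥0∞) (x : En n) :
    a ^ (1 - 1 / s) ≤ min a (N * weight x ^ (-s)) ^ (1 - 1 / s) + N ^ (-(1 / s)) * (a * weight x)
      ∧ (N * weight x ^ (-s)) ^ (1 - 1 / s) = N ^ (1 - 1 / s) * weight x ^ (-(s - 1)) := by
  obtain ⟨h0, h1⟩ := one_sub_one_div_lt_one hs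
  have hs0 : s ≠ 0 := by
    have := (n.cast_nonneg : (0 : ℝ) ≤ n)
    intro h
    linarith
  have hw0 : weight x ^ (-s) ≠ 0 :=
    (ENNReal.rpow_pos (pos_iff_ne_zero.2 (weight_ne_zero x)) (weight_ne_top x)).ne'
  have hwt : weight x ^ (-s) ≠ ⊤ := ENNReal.rpow_ne_top_of_ne_zero (weight_ne_zero x)
    (weight_ne_top x)
  constructor
  · refine (ENNReal.rpow_le_min_rpow_add (mul_ne_zero hN0 hw0) (ENNReal.mul_ne_top hNt hwt)
      h1.le).trans_eq ?_
    have e1 : 1 - 1 / s - 1 = -(1 / s) := by ring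
    have e2 : -s * -(1 / s) = 1 := by field_simp
    rw [e1, ENNReal.mul_rpow_of_ne_zero hN0 hw0, ← ENNReal.rpow_mul, e2, ENNReal.rpow_one,
      mul_comm a, mul_assoc]
  · have e : -s * (1 - 1 / s) = -(s - 1) := by
      field_simp
    rw [ENNReal.mul_rpow_of_nonneg _ _ h0.le, ← ENNReal.rpow_mul, e]

theorem lintegral_rpow_le_of_weight {n : ℕ} {s : ℝ} (hs : n + 1 < s) {N : ℝ≥0∞} (hN0 : N ≠ 0)
    (hNt : N ≠ ⊤) {u : En n → ℝ≥0∞} (hu : Measurable u) :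
    ∫⁻ x, u x ^ (1 - 1 / s) ≤
      (N ^ (1 - 1 / s) * ∫⁻ x : En n, weight x ^ (-(s - 1)))
        + N ^ (-(1 / s)) * ∫⁻ x, u x * weight x := by
  rw [← lintegral_const_mul _ (by fun_prop), ← lintegral_const_mul _ (by fun_prop),
    ← lintegral_add_left (by fun_prop)]
  refine lintegral_mono fun x => ?_
  obtain ⟨h1, h2⟩ := rpow_le_min_rpow_add_weight hs hN0 hNt (u x) x
  refine h1.trans ?_
  rw [← h2]
  gcongr
  · exact (one_sub_one_div_lt_one hs).1.le
  · exact min_le_right _ _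

theorem limsup_lintegral_rpow_le {n : ℕ} {s : ℝ} (hs : n + 1 < s) {u : ℕ → En n → ℝ≥0∞}
    {v : En n → ℝ≥0∞} (hu : ∀ k, Measurable (u k))
    (hlim : ∀ᵐ x, limsup (fun k => u k x) atTop ≤ v x) {C : ℝ≥0∞} (hC : C ≠ ⊤)
    (huC : ∀ k, ∫⁻ x, u k x * weight x ≤ C) :
    limsup (fun k => ∫⁻ x, u k x ^ (1 - 1 / s)) atTop ≤ ∫⁻ x, v x ^ (1 - 1 / s) := by
  obtain ⟨hα0, hα1⟩ := one_sub_one_div_lt_one hs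
  have hs0 : 0 < 1 / s := by linarith
  have hN : ∀ N : ℕ, limsup (fun k => ∫⁻ x, u k x ^ (1 - 1 / s)) atTop ≤
      (∫⁻ x, v x ^ (1 - 1 / s)) + ((N + 1 : ℕ) : ℝ≥0∞) ^ (-(1 / s)) * C := by
    intro N
    set b : En n → ℝ≥0∞ := fun x => ((N + 1 : ℕ) : ℝ≥0∞) * weight x ^ (-s) with hb
    have hN0 : ((N + 1 : ℕ) : ℝ≥0∞) ≠ 0 := by exact_mod_cast N.succ_ne_zero
    have hNt : ((N + 1 : ℕ) : ℝ≥0∞) ≠ ⊤ := ENNReal.natCast_ne_top _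
    have hbm : Measurable b := by fun_prop
    have h1 : ∀ k, ∫⁻ x, u k x ^ (1 - 1 / s) ≤
        (∫⁻ x, min (u k x) (b x) ^ (1 - 1 / s)) + ((N + 1 : ℕ) : ℝ≥0∞) ^ (-(1 / s)) * C := by
      intro k
      refine (lintegral_mono fun x =>
        (rpow_le_min_rpow_add_weight hs hN0 hNt (u k x) x).1).trans ?_
      have hm : Measurable fun x => u k x * weight x := (hu k).mul measurable_weight
      rw [lintegral_add_left (((hu k).min hbm).pow_const _), lintegral_const_mul _ hm]
      gcongr
      exact huC k
    refine (limsup_le_limsup (Eventually.of_forall h1)).trans ?_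
    rw [limsup_add_const _ _ _ (by isBoundedDefault) (by isBoundedDefault)]
    gcongr
    refine (limsup_lintegral_le (fun x => b x ^ (1 - 1 / s))
      (fun k => ((hu k).min hbm).pow_const _) (fun k => ae_of_all _ fun x => ?_) ?_).trans
      (lintegral_mono_ae ?_)
    · exact ENNReal.rpow_le_rpow (min_le_right _ _) hα0.le
    · have : ∀ x : En n, b x ^ (1 - 1 / s) =
          ((N + 1 : ℕ) : ℝ≥0∞) ^ (1 - 1 / s) * weight x ^ (-(s - 1)) := fun x =>
        (rpow_le_min_rpow_add_weight hs hN0 hNt 0 x).2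
      simp only [this]
      rw [lintegral_const_mul _ (by fun_prop)]
      exact ENNReal.mul_ne_top (ENNReal.rpow_ne_top_of_nonneg hα0.le hNt)
        (lintegral_weight_rpow_ne_top hs)
    · filter_upwards [hlim] with x hx
      have h2 : limsup (fun k => u k x ^ (1 - 1 / s)) atTop =
          (limsup (fun k => u k x) atTop) ^ (1 - 1 / s) :=
        (OrderIso.limsup_apply (ENNReal.orderIsoRpow (1 - 1 / s) hα0) (by isBoundedDefault)
          (by isBoundedDefault) (by isBoundedDefault) (by isBoundedDefault)).symm
      refine le_trans (limsup_le_limsup (Eventually.of_forall fun k => ?_))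
        (h2.trans_le (ENNReal.rpow_le_rpow hx hα0.le))
      exact ENNReal.rpow_le_rpow (min_le_left _ _) hα0.le
  have hlim0 : Tendsto (fun N : ℕ => ((N + 1 : ℕ) : ℝ≥0∞) ^ (-(1 / s))) atTop (𝓝 0) := by
    simp only [ENNReal.rpow_neg]
    rw [← ENNReal.inv_top]
    refine tendsto_inv_iff.2 ?_
    exact ((ENNReal.tendsto_rpow_at_top hs0).comp ENNReal.tendsto_nat_nhds_top).comp
      (tendsto_add_atTop_nat 1)
  have := (ENNReal.Tendsto.mul_const hlim0 (Or.inr hC)).const_add (∫⁻ x, v x ^ (1 - 1 / s))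
  rw [zero_mul, add_zero] at this
  exact ge_of_tendsto' this hN

/-! ### Means over balls -/

theorem lintegral_setLIntegral_closedBall {n : ℕ} (ν : Measure (En n)) [SFinite ν] {δ : ℝ}
    {g : En n → ℝ≥0∞} (hg : Measurable g) :
    ∫⁻ x : En n, ∫⁻ y in Metric.closedBall x δ, g y ∂ν =
      volume (Metric.closedBall (0 : En n) δ) * ∫⁻ y, g y ∂ν := by
  have hS : MeasurableSet {p : En n × En n | dist p.2 p.1 ≤ δ} :=
    measurableSet_le (by fun_prop) (by fun_prop)
  have e : ∀ x : En n, ∫⁻ y in Metric.closedBall x δ, g y ∂ν =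
      ∫⁻ y, {p : En n × En n | dist p.2 p.1 ≤ δ}.indicator (fun p => g p.2) (x, y) ∂ν := fun x => by
    rw [← lintegral_indicator Metric.isClosed_closedBall.measurableSet]
    rfl
  have hm : Measurable ({p : En n × En n | dist p.2 p.1 ≤ δ}.indicator (fun p => g p.2)) :=
    (hg.comp measurable_snd).indicator hS
  simp only [e]
  rw [lintegral_lintegral_swap (f := fun x y => {p : En n × En n | dist p.2 p.1 ≤ δ}.indicator
    (fun p => g p.2) (x, y)) hm.aemeasurable, ← lintegral_const_mul _ hg]
  refine lintegral_congr fun y => ?_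
  have e' : ∀ x : En n, {p : En n × En n | dist p.2 p.1 ≤ δ}.indicator (fun p => g p.2) (x, y) =
      (Metric.closedBall y δ).indicator (fun _ => g y) x := fun x => by
    simp only [indicator, mem_ofPred_eq, Metric.mem_closedBall, dist_comm x y]
  simp only [e']
  rw [lintegral_indicator Metric.isClosed_closedBall.measurableSet, setLIntegral_const,
    Measure.addHaar_closedBall_center, mul_comm]

/-- The mean density of a measure over the closed ball of radius `δ`. -/
def ballMean {n : ℕ} (ρ : Measure (En n)) (δ : ℝ) (x : En n) : ℝ≥0∞ :=
  ρ (Metric.closedBall x δ) / volume (Metric.closedBall x δ)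

theorem measurable_ballMean {n : ℕ} (ρ : Measure (En n)) [SFinite ρ] (δ : ℝ) :
    Measurable (ballMean ρ δ) := by
  have hS : MeasurableSet {p : En n × En n | dist p.2 p.1 ≤ δ} :=
    measurableSet_le (by fun_prop) (by fun_prop)
  have h : Measurable fun x : En n => ρ (Metric.closedBall x δ) :=
    measurable_measure_prodMk_left (ν := ρ) hS
  unfold ballMean
  simp only [Measure.addHaar_closedBall_center]
  exact h.div_const _

theorem volume_closedBall_ne_zero {n : ℕ} {δ : ℝ} (hδ : 0 < δ) :
    volume (Metric.closedBall (0 : En n) δ) ≠ 0 :=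
  (Metric.measure_closedBall_pos volume _ hδ).ne'

theorem volume_closedBall_ne_top {n : ℕ} {δ : ℝ} :
    volume (Metric.closedBall (0 : En n) δ) ≠ ⊤ :=
  measure_closedBall_lt_top.ne

theorem lintegral_rnDeriv_rpow_le_ballMean {n : ℕ} (ρ : Measure (En n)) [SFinite ρ] {δ : ℝ} (hδ : 0 < δ)
    {α : ℝ} (h0 : 0 ≤ α) (h1 : α ≤ 1) :
    ∫⁻ x, ρ.rnDeriv volume x ^ α ≤ ∫⁻ x, ballMean ρ δ x ^ α := by
  set r := ρ.rnDeriv volume with hr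
  have hrm : Measurable r := Measure.measurable_rnDeriv _ _
  set V := volume (Metric.closedBall (0 : En n) δ) with hV
  have hV0 : V ≠ 0 := volume_closedBall_ne_zero hδ
  have hVt : V ≠ ⊤ := volume_closedBall_ne_top
  have key : ∀ x : En n, ∫⁻ y in Metric.closedBall x δ, r y ^ α ≤ V * ballMean ρ δ x ^ α := by
    intro x
    have hvol : volume (Metric.closedBall x δ) = V := Measure.addHaar_closedBall_center _ _ _
    have h := ENNReal.lintegral_mul_norm_pow_le (μ := volume.restrict (Metric.closedBall x δ))
      (f := r) (g := fun _ => 1) hrm.aemeasurable aemeasurable_const h0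
      (sub_nonneg.2 h1) (by ring)
    simp only [ENNReal.one_rpow, mul_one, setLIntegral_one, hvol] at h
    refine h.trans ?_
    have h2 : ∫⁻ y in Metric.closedBall x δ, r y ≤ ρ (Metric.closedBall x δ) :=
      Measure.setLIntegral_rnDeriv_le _
    rw [ballMean, hvol, ENNReal.div_rpow_of_nonneg _ _ h0, ENNReal.rpow_sub _ _ hV0 hVt,
      ENNReal.rpow_one, ENNReal.div_eq_inv_mul, ENNReal.div_eq_inv_mul, mul_left_comm V,
      mul_left_comm (_ ^ α), mul_comm V]
    gcongr
  have h3 := lintegral_mono (μ := volume) key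
  rw [lintegral_setLIntegral_closedBall volume (hrm.pow_const α),
    lintegral_const_mul _ ((measurable_ballMean ρ δ).pow_const α)] at h3
  exact (ENNReal.mul_le_mul_iff_right hV0 hVt).1 h3

theorem lintegral_ballMean_mul_weight_le {n : ℕ} (ρ : Measure (En n)) [IsProbabilityMeasure ρ]
    {δ : ℝ} (hδ : 0 < δ) :
    ∫⁻ x, ballMean ρ δ x * weight x ≤ (∫⁻ x, weight x ∂ρ) + ENNReal.ofReal δ := by
  set V := volume (Metric.closedBall (0 : En n) δ) with hV
  have hV0 : V ≠ 0 := volume_closedBall_ne_zero hδ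
  have hVt : V ≠ ⊤ := volume_closedBall_ne_top
  have key : ∀ x : En n, ballMean ρ δ x * weight x ≤
      V⁻¹ * ∫⁻ y in Metric.closedBall x δ, (weight y + ENNReal.ofReal δ) ∂ρ := by
    intro x
    have hvol : volume (Metric.closedBall x δ) = V := Measure.addHaar_closedBall_center _ _ _
    rw [ballMean, hvol, ENNReal.div_eq_inv_mul, mul_assoc, mul_comm (ρ _), ← setLIntegral_const]
    gcongr 1
    refine setLIntegral_mono' Metric.isClosed_closedBall.measurableSet fun y hy => ?_
    rw [weight, weight, ← ENNReal.ofReal_add (by positivity) hδ.le]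
    refine ENNReal.ofReal_le_ofReal ?_
    have h1 := norm_le_norm_add_norm_sub' x y
    rw [Metric.mem_closedBall, dist_comm, dist_eq_norm] at hy
    linarith
  refine (lintegral_mono key).trans_eq ?_
  have hm : Measurable fun x : En n => weight x + ENNReal.ofReal δ := by fun_prop
  rw [lintegral_const_mul' _ _ (ENNReal.inv_ne_top.2 hV0), lintegral_setLIntegral_closedBall ρ hm,
    ← mul_assoc, ENNReal.inv_mul_cancel hV0 hVt, one_mul, lintegral_add_left measurable_weight]
  simp

theorem lintegral_rnDeriv_mul_weight_le {n : ℕ} (ρ : Measure (En n)) :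
    ∫⁻ x, ρ.rnDeriv volume x * weight x ≤ ∫⁻ x, weight x ∂ρ := by
  have h := lintegral_withDensity_eq_lintegral_mul volume (ρ.measurable_rnDeriv volume)
    (measurable_weight (n := n))
  simp only [Pi.mul_apply] at h
  rw [← h]
  exact lintegral_mono' (Measure.withDensity_rnDeriv_le _ _) le_rfl

theorem limsup_lintegral_rnDeriv_rpow_le {n : ℕ} {s : ℝ} (hs : n + 1 < s)
    {ρk : ℕ → ProbabilityMeasure (En n)} {ρ : ProbabilityMeasure (En n)}
    (hlim : Tendsto ρk atTop (𝓝 ρ)) {C : ℝ≥0∞} (hC : C ≠ ⊤)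
    (hkC : ∀ k, ∫⁻ x, weight x ∂(ρk k : Measure (En n)) ≤ C)
    (hρC : ∫⁻ x, weight x ∂(ρ : Measure (En n)) ≤ C) :
    limsup (fun k => ∫⁻ x, (ρk k : Measure (En n)).rnDeriv volume x ^ (1 - 1 / s)) atTop ≤
      ∫⁻ x, (ρ : Measure (En n)).rnDeriv volume x ^ (1 - 1 / s) := by
  obtain ⟨h0, h1⟩ := one_sub_one_div_lt_one hs
  set δ : ℕ → ℝ := fun m => 1 / ((m : ℝ) + 1) with hδ
  have hδ0 : ∀ m, 0 < δ m := fun m => by positivity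
  have hδ1 : ∀ m, δ m ≤ 1 := fun m => by
    rw [hδ, div_le_one (by positivity)]
    linarith [(m.cast_nonneg : (0 : ℝ) ≤ m)]
  have hC1 : C + ENNReal.ofReal 1 ≠ ⊤ := ENNReal.add_ne_top.2 ⟨hC, ENNReal.ofReal_ne_top⟩
  have hball : ∀ (ν : ProbabilityMeasure (En n)) (m : ℕ),
      ∫⁻ x, weight x ∂(ν : Measure (En n)) ≤ C →
      ∫⁻ x, ballMean (ν : Measure (En n)) (δ m) x * weight x ≤ C + ENNReal.ofReal 1 :=
    fun ν m h => (lintegral_ballMean_mul_weight_le _ (hδ0 m)).trans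
      (add_le_add h (ENNReal.ofReal_le_ofReal (hδ1 m)))
  have hA : ∀ m, limsup (fun k => ∫⁻ x, (ρk k : Measure (En n)).rnDeriv volume x ^ (1 - 1 / s))
      atTop ≤ ∫⁻ x, ballMean (ρ : Measure (En n)) (δ m) x ^ (1 - 1 / s) := by
    intro m
    refine (limsup_le_limsup (Eventually.of_forall fun k =>
      lintegral_rnDeriv_rpow_le_ballMean (ρk k : Measure (En n)) (hδ0 m) h0.le h1.le)).trans ?_
    refine limsup_lintegral_rpow_le hs (fun k => measurable_ballMean _ _)
      (ae_of_all _ fun x => ?_) hC1 fun k => hball (ρk k) m (hkC k)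
    have hV0 : volume (Metric.closedBall x (δ m)) ≠ 0 :=
      (Metric.measure_closedBall_pos volume _ (hδ0 m)).ne'
    simp only [ballMean, ENNReal.div_eq_inv_mul]
    rw [ENNReal.limsup_const_mul_of_ne_top (ENNReal.inv_ne_top.2 hV0)]
    exact mul_le_mul_right (ProbabilityMeasure.limsup_measure_closed_le_of_tendsto hlim
      Metric.isClosed_closedBall) _
  have hδlim : Tendsto δ atTop (𝓝[>] 0) :=
    tendsto_nhdsWithin_iff.2 ⟨tendsto_one_div_add_atTop_nhds_zero_nat,
      Eventually.of_forall hδ0⟩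
  refine le_trans ?_ (limsup_lintegral_rpow_le hs
    (u := fun m => ballMean (ρ : Measure (En n)) (δ m)) (fun m => measurable_ballMean _ _)
    ?_ hC1 fun m => hball ρ m hρC)
  · exact le_trans (by rw [limsup_const]) (limsup_le_limsup (Eventually.of_forall hA))
  · filter_upwards [Besicovitch.ae_tendsto_rnDeriv (ρ : Measure (En n)) volume] with x hx
    exact (hx.comp hδlim).limsup_eq.le

theorem Ffun_eq {n : ℕ} {q : ℝ} (hq : 1 < q) (ρ : Measure (En n)) [IsFiniteMeasure ρ] :
    Ffun n q ρ = -((ENNReal.ofReal (1 / (1 - 1 / ((n : ℝ) + q))) *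
      ∫⁻ x, ρ.rnDeriv volume x ^ (1 - 1 / ((n : ℝ) + q)) : ℝ≥0∞) : EReal) := by
  have h0 := (one_sub_one_div_lt_one (n := n) (s := n + q) (by linarith)).1
  have h : ∫⁻ x, ENNReal.ofReal ((ρ.rnDeriv volume x).toReal ^ (1 - 1 / ((n : ℝ) + q)) /
      (1 - 1 / ((n : ℝ) + q))) = ENNReal.ofReal (1 / (1 - 1 / ((n : ℝ) + q))) *
      ∫⁻ x, ρ.rnDeriv volume x ^ (1 - 1 / ((n : ℝ) + q)) := by
    rw [← lintegral_const_mul _ ((ρ.measurable_rnDeriv volume).pow_const _)]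
    refine lintegral_congr_ae ?_
    filter_upwards [ρ.rnDeriv_lt_top volume] with x hx
    rw [div_eq_mul_one_div, mul_comm, ENNReal.ofReal_mul (by positivity),
      ← ENNReal.ofReal_rpow_of_nonneg ENNReal.toReal_nonneg h0.le, ENNReal.ofReal_toReal hx.ne]
  rw [Ffun, h]

theorem lintegral_weight_eq {n : ℕ} {ρ : Measure (En n)} [IsProbabilityMeasure ρ] (hρ : P1 ρ) :
    ∫⁻ x, weight x ∂ρ = ENNReal.ofReal (1 + ∫ x, ‖x‖ ∂ρ) := by
  have hi : Integrable (fun x : En n => 1 + ‖x‖) ρ := (integrable_const 1).add hρ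
  simp only [weight]
  rw [← ofReal_integral_eq_lintegral_ofReal hi (ae_of_all _ fun x => by positivity),
    integral_add (integrable_const 1) hρ]
  simp

/-- The local functional is dominated by an arbitrarily small multiple of the first moment. -/
theorem exists_Ffun_lower_bound {n : ℕ} {q : ℝ} (hq : 1 < q) {ε : ℝ} (hε : 0 < ε) :
    ∃ K : ℝ, ∀ ρ : Measure (En n), IsProbabilityMeasure ρ → P1 ρ →
      ((-K - ε * ∫ x, ‖x‖ ∂ρ : ℝ) : EReal) ≤ Ffun n q ρ := by
  set s : ℝ := n + q with hs'
  have hs : (n : ℝ) + 1 < s := by linarith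
  obtain ⟨h0, h1⟩ := one_sub_one_div_lt_one hs
  have hs0 : 0 < 1 / s := by linarith
  set β : ℝ := 1 / (1 - 1 / s) with hβ
  have hβ0 : 0 < β := by positivity
  set N : ℝ := (ε / β) ^ (-s) with hN
  have hN0 : 0 < N := by positivity
  have hNε : N ^ (-(1 / s)) = ε / β := by
    rw [hN, ← Real.rpow_mul (by positivity)]
    have : -s * -(1 / s) = 1 := by
      have : s ≠ 0 := by rintro h; simp [h] at hs0
      field_simp
    rw [this, Real.rpow_one]
  set W := ∫⁻ x : En n, weight x ^ (-(s - 1)) with hW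
  have hWt : W ≠ ⊤ := lintegral_weight_rpow_ne_top hs
  refine ⟨β * (N ^ (1 - 1 / s) * W.toReal) + ε, fun ρ hρp hρ => ?_⟩
  have hM : 0 ≤ ∫ x, ‖x‖ ∂ρ := integral_nonneg fun x => norm_nonneg x
  have hb := lintegral_rpow_le_of_weight hs (N := ENNReal.ofReal N)
    (ENNReal.ofReal_pos.2 hN0).ne' ENNReal.ofReal_ne_top (ρ.measurable_rnDeriv volume)
  have hb2 : ∫⁻ x, ρ.rnDeriv volume x ^ (1 - 1 / s) ≤
      ENNReal.ofReal (N ^ (1 - 1 / s) * W.toReal + ε / β * (1 + ∫ x, ‖x‖ ∂ρ)) := by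
    refine hb.trans ?_
    rw [ENNReal.ofReal_add (by positivity) (by positivity),
      ENNReal.ofReal_mul (by positivity), ENNReal.ofReal_toReal hWt,
      ENNReal.ofReal_mul (by positivity), ENNReal.ofReal_rpow_of_pos hN0,
      ENNReal.ofReal_rpow_of_pos hN0, hNε, ← lintegral_weight_eq hρ]
    exact add_le_add le_rfl (mul_le_mul_right (lintegral_rnDeriv_mul_weight_le ρ) _)
  rw [Ffun_eq hq, EReal.le_neg, ← EReal.coe_neg]
  refine (EReal.coe_ennreal_le_coe_ennreal_iff.2 (mul_le_mul_right hb2 _)).trans ?_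
  rw [← ENNReal.ofReal_mul hβ0.le, EReal.coe_ennreal_ofReal, max_eq_left (by positivity),
    EReal.coe_le_coe_iff]
  have e : β * (ε / β * (1 + ∫ x, ‖x‖ ∂ρ)) = ε * (1 + ∫ x, ‖x‖ ∂ρ) := by
    field_simp
  rw [mul_add, e]
  linarith

theorem eventually_lt_Ffun {n : ℕ} {q : ℝ} (hq : 1 < q)
    {ρk : ℕ → ProbabilityMeasure (En n)} {ρ : ProbabilityMeasure (En n)}
    (hlim : Tendsto ρk atTop (𝓝 ρ)) {C : ℝ≥0∞} (hC : C ≠ ⊤)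
    (hkC : ∀ k, ∫⁻ x, weight x ∂(ρk k : Measure (En n)) ≤ C)
    (hρC : ∫⁻ x, weight x ∂(ρ : Measure (En n)) ≤ C) {t : ℝ}
    (ht : (t : EReal) < Ffun n q (ρ : Measure (En n))) :
    ∀ᶠ k in atTop, (t : EReal) < Ffun n q (ρk k : Measure (En n)) := by
  have hs : (n : ℝ) + 1 < n + q := by linarith
  have hiff : ∀ a : ℝ≥0∞, (t : EReal) < -(a : EReal) ↔ a < ENNReal.ofReal (-t) := by
    intro a
    rw [EReal.lt_neg_comm, ← EReal.coe_neg]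
    rcases le_total 0 (-t) with h | h
    · rw [← EReal.coe_ennreal_lt_coe_ennreal_iff, EReal.coe_ennreal_ofReal, max_eq_left h]
    · rw [ENNReal.ofReal_of_nonpos h]
      simp only [not_lt_zero, iff_false, not_lt]
      exact (EReal.coe_le_coe_iff.2 h).trans (EReal.coe_ennreal_nonneg a)
  simp only [Ffun_eq hq, hiff] at ht ⊢
  refine eventually_lt_of_limsup_lt (lt_of_le_of_lt ?_ ht)
  rw [ENNReal.limsup_const_mul_of_ne_top ENNReal.ofReal_ne_top]
  exact mul_le_mul_right (limsup_lintegral_rnDeriv_rpow_le hs hlim hC hkC hρC) _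

/-! ### Compactness and conclusion -/

theorem isTightMeasureSet_of_lintegral_weight_le {n : ℕ} {C : ℝ≥0∞} (hC : C ≠ ⊤) :
    IsTightMeasureSet {ρ : Measure (En n) | ∫⁻ x, weight x ∂ρ ≤ C} := by
  refine isTightMeasureSet_of_tendsto_measure_norm_gt ?_
  have hlim : Tendsto (fun r : ℝ => C / ENNReal.ofReal r) atTop (𝓝 0) := by
    have := ENNReal.Tendsto.const_div (a := C) ENNReal.tendsto_ofReal_atTop (Or.inr hC)
    rwa [ENNReal.div_top] at this
  refine tendsto_of_tendsto_of_tendsto_of_le_of_le' tendsto_const_nhds hlim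
    (Eventually.of_forall fun r => zero_le) ?_
  filter_upwards [eventually_gt_atTop 0] with r hr
  refine iSup₂_le fun ρ hρ => ?_
  calc ρ {x | r < ‖x‖} ≤ ρ {x | ENNReal.ofReal r ≤ weight x} := by
        refine measure_mono fun x hx => ENNReal.ofReal_le_ofReal ?_
        rw [mem_ofPred_eq] at hx
        linarith
    _ ≤ (∫⁻ x, weight x ∂ρ) / ENNReal.ofReal r :=
        meas_ge_le_lintegral_div (by fun_prop) (ENNReal.ofReal_pos.2 hr).ne' ENNReal.ofReal_ne_top
    _ ≤ C / ENNReal.ofReal r := ENNReal.div_le_div_right hρ _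

theorem lintegral_weight_le_of_tendsto {n : ℕ} {ρk : ℕ → ProbabilityMeasure (En n)}
    {ρ : ProbabilityMeasure (En n)} (hlim : Tendsto ρk atTop (𝓝 ρ)) {C : ℝ≥0∞}
    (hkC : ∀ k, ∫⁻ x, weight x ∂(ρk k : Measure (En n)) ≤ C) :
    ∫⁻ x, weight x ∂(ρ : Measure (En n)) ≤ C := by
  refine (lintegral_le_liminf_lintegral_of_forall_isOpen_measure_le_liminf_measure
    (f := fun x : En n => 1 + ‖x‖) (by fun_prop) (fun x => by positivity) fun G hG =>
    ProbabilityMeasure.le_liminf_measure_open_of_tendsto hlim hG).trans ?_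
  refine (liminf_le_liminf (Eventually.of_forall hkC)).trans ?_
  rw [liminf_const]

theorem P1_of_lintegral_weight_ne_top {n : ℕ} {ρ : Measure (En n)}
    (h : ∫⁻ x, weight x ∂ρ ≠ ⊤) : P1 ρ := by
  refine ⟨by fun_prop, ?_⟩
  rw [hasFiniteIntegral_iff_norm]
  refine lt_of_le_of_lt (lintegral_mono fun x => ENNReal.ofReal_le_ofReal ?_) h.lt_top
  rw [norm_norm]
  linarith

theorem exists_centered {n : ℕ} {q : ℝ} {μ : Measure (En n)} (hμ : P1 μ)
    (hbar : ∫ y, y ∂μ = (0 : En n)) {ρ : Measure (En n)} [IsProbabilityMeasure ρ] (hρ : P1 ρ) :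
    ∃ ρ' : ProbabilityMeasure (En n), P1 (ρ' : Measure (En n)) ∧
      ∫ x, x ∂(ρ' : Measure (En n)) = (0 : En n) ∧
      Jfun n q μ (ρ' : Measure (En n)) ≤ Jfun n q μ ρ := by
  set v : En n := -∫ x, x ∂ρ with hv
  have hm : Measurable fun x : En n => x + v := by fun_prop
  refine ⟨⟨ρ.map (· + v), Measure.isProbabilityMeasure_map hm.aemeasurable⟩, ?_, ?_, ?_⟩
  · refine (integrable_map_measure (by fun_prop) hm.aemeasurable).2 ?_
    exact (hρ.integrable_id.add (integrable_const v)).norm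
  · change ∫ x, x ∂(ρ.map (· + v)) = 0
    rw [integral_map hm.aemeasurable (by fun_prop), integral_add hρ.integrable_id
      (integrable_const v)]
    simp [hv]
  · change Ffun n q (ρ.map (· + v)) + Tcorr (ρ.map (· + v)) μ ≤ _
    rw [Ffun_map_add]
    exact add_le_add le_rfl (Tcorr_map_add_le hμ hbar v)

theorem exists_norm_bound_of_Jfun_le {n : ℕ} (hn : 1 ≤ n) {q : ℝ} (hq : 1 < q)
    {μ : Measure (En n)} [IsProbabilityMeasure μ] (hμ : P1 μ) (hbar : ∫ y, y ∂μ = (0 : En n))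
    (hplane : NotHyperplane μ) (A : ℝ) :
    ∃ B : ℝ, ∀ ρ : Measure (En n), IsProbabilityMeasure ρ → P1 ρ → ∫ x, x ∂ρ = (0 : En n) →
      Jfun n q μ ρ ≤ A → ∫ x, ‖x‖ ∂ρ ≤ B := by
  obtain ⟨c, hc, hT⟩ := exists_coercivity hn hμ hbar hplane
  obtain ⟨K, hF⟩ := exists_Ffun_lower_bound (n := n) hq (half_pos hc)
  refine ⟨(A + K) / (c / 2), fun ρ h1 h2 h3 hJ => ?_⟩
  have h := (add_le_add (hF ρ h1 h2) (hT ρ h1 h2 h3)).trans hJ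
  rw [← EReal.coe_add, EReal.coe_le_coe_iff] at h
  rw [le_div_iff₀ (half_pos hc)]
  linarith

theorem Jfun_le_of_tendsto {n : ℕ} {q : ℝ} (hq : 1 < q) {μ : Measure (En n)}
    [IsProbabilityMeasure μ] (hμ : P1 μ) (hbar : ∫ y, y ∂μ = (0 : En n))
    {ρk : ℕ → ProbabilityMeasure (En n)} {ρ : ProbabilityMeasure (En n)}
    (hlim : Tendsto ρk atTop (𝓝 ρ)) {C : ℝ≥0∞} (hC : C ≠ ⊤)
    (hkC : ∀ k, ∫⁻ x, weight x ∂(ρk k : Measure (En n)) ≤ C)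
    (hk0 : ∀ k, ∫ x, x ∂(ρk k : Measure (En n)) = (0 : En n)) {u : ℕ → EReal} {I : EReal}
    (hJ : ∀ k, Jfun n q μ (ρk k : Measure (En n)) ≤ u k) (hu : Tendsto u atTop (𝓝 I)) :
    Jfun n q μ (ρ : Measure (En n)) ≤ I := by
  refine EReal.add_le_of_forall_lt fun a ha b hb => ?_
  obtain ⟨a', haa', ha'⟩ := EReal.lt_iff_exists_real_btwn.1 ha
  obtain ⟨b', hbb', hb'⟩ := EReal.lt_iff_exists_real_btwn.1 hb
  refine ge_of_tendsto hu ?_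
  filter_upwards [eventually_lt_Ffun hq hlim hC hkC (lintegral_weight_le_of_tendsto hlim hkC) ha',
    eventually_lt_Tcorr hμ hbar hlim
      (fun k => P1_of_lintegral_weight_ne_top (ne_top_of_le_ne_top hC (hkC k))) hk0 hb']
    with k hFk hTk
  exact (add_le_add (haa'.trans hFk).le (hbb'.trans hTk).le).trans (hJ k)

/-- Existence of a minimizer for problem (P). -/
theorem qMomentMeasures_existence_of_minimizer
    (n : ℕ) (hn : 1 ≤ n) (q : ℝ) (hq : 1 < q)
    (μ : Measure (En n)) [IsProbabilityMeasure μ]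
    (hμ1 : P1 μ)
    (hbar : ∫ y, y ∂μ = (0 : En n))
    (hplane : NotHyperplane μ) :
    ∃ ρbar : Measure (En n), IsProbabilityMeasure ρbar ∧ P1 ρbar ∧
      ∀ ρ : Measure (En n), IsProbabilityMeasure ρ → P1 ρ →
        Jfun n q μ ρbar ≤ Jfun n q μ ρ := by
  set S : Set EReal := {a | ∃ ρ : Measure (En n), IsProbabilityMeasure ρ ∧ P1 ρ ∧
    Jfun n q μ ρ = a} with hS
  suffices h : ∃ ρbar : Measure (En n), IsProbabilityMeasure ρbar ∧ P1 ρbar ∧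
      Jfun n q μ ρbar ≤ sInf S by
    obtain ⟨ρbar, h1, h2, h3⟩ := h
    exact ⟨ρbar, h1, h2, fun ρ hρp hρ => h3.trans (sInf_le ⟨ρ, hρp, hρ, rfl⟩)⟩
  have hdirac : P1 (Measure.dirac (0 : En n)) := integrable_dirac (by simp)
  rcases eq_or_ne (sInf S) ⊤ with htop | htop
  · exact ⟨Measure.dirac 0, inferInstance, hdirac, htop ▸ le_top⟩
  obtain ⟨A, hA, -⟩ := EReal.lt_iff_exists_real_btwn.1 htop.lt_top
  obtain ⟨u, hu_anti, hu, huS⟩ := exists_seq_tendsto_sInf (S := S)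
    ⟨_, Measure.dirac 0, inferInstance, hdirac, rfl⟩ (OrderBot.bddBelow S)
  obtain ⟨k₀, hk₀⟩ := (hu.eventually_lt_const hA).exists
  have hex : ∀ k, ∃ ρ' : ProbabilityMeasure (En n), P1 (ρ' : Measure (En n)) ∧
      ∫ x, x ∂(ρ' : Measure (En n)) = (0 : En n) ∧
      Jfun n q μ (ρ' : Measure (En n)) ≤ u (k + k₀) := fun k => by
    obtain ⟨ρ, hρp, hρ, hρu⟩ := huS (k + k₀)
    rw [← hρu]
    exact exists_centered hμ1 hbar hρ
  choose σ hσ1 hσ0 hσJ using hex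
  obtain ⟨B, hB⟩ := exists_norm_bound_of_Jfun_le hn hq hμ1 hbar hplane A
  have hσC : ∀ k, ∫⁻ x, weight x ∂(σ k : Measure (En n)) ≤ ENNReal.ofReal (1 + B) := fun k => by
    rw [lintegral_weight_eq (hσ1 k)]
    refine ENNReal.ofReal_le_ofReal (add_le_add le_rfl (hB _ inferInstance (hσ1 k) (hσ0 k) ?_))
    exact (hσJ k).trans ((hu_anti (Nat.le_add_left _ _)).trans hk₀.le)
  have htight : IsTightMeasureSet
      {((ρ : ProbabilityMeasure (En n)) : Measure (En n)) | ρ ∈ range σ} := by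
    refine (isTightMeasureSet_of_lintegral_weight_le
      (C := ENNReal.ofReal (1 + B)) ENNReal.ofReal_ne_top).subset ?_
    rintro _ ⟨_, ⟨k, rfl⟩, rfl⟩
    exact hσC k
  obtain ⟨ρ, -, φ, hφ, hlim⟩ := (isCompact_closure_of_isTightMeasureSet htight).tendsto_subseq
    fun k => subset_closure (mem_range_self k)
  have hu' : Tendsto (fun k => u (φ k + k₀)) atTop (𝓝 (sInf S)) :=
    (hu.comp (tendsto_add_atTop_nat k₀)).comp hφ.tendsto_atTop
  exact ⟨ρ, inferInstance, P1_of_lintegral_weight_ne_top (ne_top_of_le_ne_top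
    ENNReal.ofReal_ne_top (lintegral_weight_le_of_tendsto hlim fun k => hσC (φ k))),
    Jfun_le_of_tendsto hq hμ1 hbar hlim ENNReal.ofReal_ne_top (fun k => hσC (φ k))
      (fun k => hσ0 (φ k)) (fun k => hσJ (φ k)) hu'⟩

end
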